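/- Let K ∈ C¹(H²) have a stable critical point in an open set A whose closure is a compact subset of H². Then there exists k₀>1 such that for every k>k₀ there exists ε₀>0 such that for every real ε with |ε|<ε₀ there exists an embedded (k+εK)-loop, i.e. an embedded nonconstant C² 2π-periodic solution of u'' − u₂⁻¹Γ(u') = L(u)(k+εK(u)) iu'. -/

import Mathlib

open Real MeasureTheory Filter Topology

noncomputable section

/-- Rotation by π/2 in the plane: `iw = (-w₂, w₁)`. -/
def rot (w : ℝ × ℝ) : ℝ × ℝ := (-w.2, w.1)

/-- The Christoffel-type term `Γ(w) = (2w₁w₂, w₂² - w₁²)`. -/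
def Gam (w : ℝ × ℝ) : ℝ × ℝ := (2 * w.1 * w.2, w.2 ^ 2 - w.1 ^ 2)

/-- Euclidean dot product in ℝ². -/
def dotp (v w : ℝ × ℝ) : ℝ := v.1 * w.1 + v.2 * w.2

/-- The hyperbolic length-type functional `L(u) = ((1/2π)∫₀^{2π} u₂⁻²|u'|² dt)^{1/2}`. -/
def hypL (u : ℝ → ℝ × ℝ) : ℝ :=
  Real.sqrt ((1 / (2 * π)) * ∫ t in (0:ℝ)..(2 * π),
    ((deriv u t).1 ^ 2 + (deriv u t).2 ^ 2) / (u t).2 ^ 2)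

/-- `u` is a `K`-loop in the upper half-plane model of the hyperbolic plane:
a nonconstant C² `2π`-periodic curve with values in `H²` solving
`u'' - u₂⁻¹ Γ(u') = L(u) K(u) iu'`. -/
def IsKLoop (K : (ℝ × ℝ) → ℝ) (u : ℝ → ℝ × ℝ) : Prop :=
  ContDiff ℝ 2 u ∧ Function.Periodic u (2 * π) ∧ (∀ t, 0 < (u t).2) ∧
  (¬ ∃ c, ∀ t, u t = c) ∧
  ∀ t, deriv (deriv u) t - ((u t).2)⁻¹ • Gam (deriv u t)
      = (hypL u * K (u t)) • rot (deriv u t)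

/-- A `2π`-periodic curve is embedded if it is injective modulo `2π`. -/
def IsEmbedded (u : ℝ → ℝ × ℝ) : Prop :=
  ∀ t s : ℝ, u t = u s → ∃ n : ℤ, t - s = 2 * π * (n : ℝ)

/-- `R_k = (k² - 1)^{-1/2}`. -/
def Rk (k : ℝ) : ℝ := 1 / Real.sqrt (k ^ 2 - 1)

/-- The reference loop `ω(t) = (cos t, 1/R_k) / (k - sin t)`, a parameterization of the
hyperbolic circle of center `(0,1)` and hyperbolic radius `ρ_k = artanh(1/k)`. -/
def om (k : ℝ) (t : ℝ) : ℝ × ℝ := (cos t / (k - sin t), (1 / Rk k) / (k - sin t))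

/-- The translated reference circle `ω_z(t) = (z₁ + z₂ω₁(t), z₂ω₂(t))`, a parameterization
of the hyperbolic circle of center `z` and hyperbolic radius `ρ_k`. -/
def omz (k : ℝ) (z : ℝ × ℝ) (t : ℝ) : ℝ × ℝ :=
  (z.1 + z.2 * (om k t).1, z.2 * (om k t).2)

/-- The Euclidean norm on `ℝ × ℝ`. -/
def enorm2 (w : ℝ × ℝ) : ℝ := Real.sqrt (w.1 ^ 2 + w.2 ^ 2)

/-- The Euclidean open disk of center `c` and radius `r` in `ℝ × ℝ`. -/
def EBall (c : ℝ × ℝ) (r : ℝ) : Set (ℝ × ℝ) :=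
  {p : ℝ × ℝ | (p.1 - c.1) ^ 2 + (p.2 - c.2) ^ 2 < r ^ 2}

/-- The Melnikov function `F_k^K(z) = ∫_{D^H_{ρ_k}(z)} K(p) p₂⁻² dp`, the disk
`D^H_{ρ_k}(z)` being the Euclidean disk of center `(z₁, kR_k z₂)` and radius `R_k z₂`. -/
def Fmel (k : ℝ) (K : (ℝ × ℝ) → ℝ) (z : ℝ × ℝ) : ℝ :=
  ∫ p in EBall ((z.1, k * Rk k * z.2) : ℝ × ℝ) (Rk k * z.2), K p / p.2 ^ 2

/-- `X` has a stable critical point in the bounded open set `A`: some `C¹`-neighborhood of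
`X` consists of functions having a critical point in `A`. -/
def HasStableCriticalPt (X : (ℝ × ℝ) → ℝ) (A : Set (ℝ × ℝ)) : Prop :=
  ∃ r > (0:ℝ), ∀ G : (ℝ × ℝ) → ℝ,
    (∃ U : Set (ℝ × ℝ), IsOpen U ∧ closure A ⊆ U ∧ ContDiffOn ℝ 1 G U) →
    (∀ z ∈ closure A, |G z - X z| + ‖fderiv ℝ G z - fderiv ℝ X z‖ < r) →
    ∃ z ∈ A, fderiv ℝ G z = 0

/-- A curve parametrized by its tangent angle over a full turn has no self-intersection. -/
theorem tangentAngle_injective_mod {x Y ρ : ℝ → ℝ}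
    (hx : ∀ θ, HasDerivAt x (ρ θ * cos θ) θ) (hY : ∀ θ, HasDerivAt Y (ρ θ * sin θ) θ)
    (hρ : ∀ θ, 0 < ρ θ) (hpx : Function.Periodic x (2 * π)) (hpY : Function.Periodic Y (2 * π))
    {a b : ℝ} (hxab : x a = x b) (hYab : Y a = Y b) : ∃ n : ℤ, a - b = 2 * π * (n : ℝ) := by
  have arc : ∀ p q : ℝ, p < q → q ≤ p + π → x p = x q → Y p = Y q → False := by
    intro p q hpq hqp h1 h2
    set m := (p + q) / 2 with hm
    have hmono : StrictMonoOn (fun θ => cos m * x θ + sin m * Y θ) (Set.Icc p q) := by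
      apply strictMonoOn_of_deriv_pos (convex_Icc p q)
      · exact fun θ _ => (((hx θ).const_mul (cos m)).add
          ((hY θ).const_mul (sin m))).continuousAt.continuousWithinAt
      · intro θ hθ
        rw [interior_Icc] at hθ
        have hd : HasDerivAt (fun θ => cos m * x θ + sin m * Y θ) _ θ :=
          ((hx θ).const_mul (cos m)).add ((hY θ).const_mul (sin m))
        rw [hd.deriv]
        have hcos : 0 < cos (θ - m) := by
          apply cos_pos_of_mem_Ioo
          constructor <;> linarith [hθ.1, hθ.2]
        have := mul_pos (hρ θ) hcos
        rw [cos_sub] at this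
        linarith
    have := hmono (Set.left_mem_Icc.2 hpq.le) (Set.right_mem_Icc.2 hpq.le) hpq
    simp only [h1, h2, lt_irrefl] at this
  have hpi := Real.pi_pos
  obtain ⟨n, hn, -⟩ := existsUnique_sub_zsmul_mem_Ico (two_pi_pos) a b
  rw [zsmul_eq_mul] at hn
  have ex : x (a - n * (2 * π)) = x b := by rw [hpx.sub_int_mul_eq, hxab]
  have eY : Y (a - n * (2 * π)) = Y b := by rw [hpY.sub_int_mul_eq, hYab]
  set a' := a - n * (2 * π) with ha'
  rcases eq_or_lt_of_le hn.1 with h | h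
  · exact ⟨n, by rw [h, ha']; ring⟩
  · exfalso
    rcases le_or_gt a' (b + π) with h' | h'
    · exact arc b a' h h' ex.symm eY.symm
    · exact arc a' (b + 2 * π) hn.2 (by linarith) (by rw [hpx b, ex]) (by rw [hpY b, eY])

/-- Time change: a positive periodic speed `h` on the circle becomes, after normalization of the
total time to `2π`, an autonomous flow. -/
theorem exists_periodic_time_change {h : ℝ → ℝ} (hc : Continuous h) (hpos : ∀ θ, 0 < h θ)
    (hper : Function.Periodic h (2 * π)) :
    ∃ c > (0 : ℝ), ∃ Θ : ℝ → ℝ, (∀ t, HasDerivAt Θ (c * h (Θ t)) t) ∧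
      (∀ t, Θ (t + 2 * π) = Θ t + 2 * π) ∧ Function.Injective Θ := by
  have hpi := Real.two_pi_pos
  have hci : Continuous fun θ => (h θ)⁻¹ := hc.inv₀ fun θ => (hpos θ).ne'
  have hperi : Function.Periodic (fun θ => (h θ)⁻¹) (2 * π) := fun θ => by simp only [hper θ]
  set J := ∫ θ in (0 : ℝ)..(2 * π), (h θ)⁻¹ with hJ
  have hJpos : 0 < J := intervalIntegral.intervalIntegral_pos_of_pos
    (hci.intervalIntegrable _ _) (fun θ => inv_pos.2 (hpos θ)) hpi
  set c := J / (2 * π) with hcdef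
  have hcpos : 0 < c := by positivity
  set σ : ℝ → ℝ := fun θ => c⁻¹ * ∫ s in (0 : ℝ)..θ, (h s)⁻¹ with hσ
  have hσd : ∀ θ, HasDerivAt σ (c⁻¹ * (h θ)⁻¹) θ := fun θ =>
    (intervalIntegral.integral_hasDerivAt_right (hci.intervalIntegrable _ _)
      (hci.stronglyMeasurableAtFilter _ _) hci.continuousAt).const_mul _
  have hσpos : ∀ θ, 0 < c⁻¹ * (h θ)⁻¹ := fun θ => mul_pos (inv_pos.2 hcpos) (inv_pos.2 (hpos θ))
  have hmono : StrictMono σ := strictMono_of_deriv_pos fun θ => by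
    rw [(hσd θ).deriv]; exact hσpos θ
  have hσper : ∀ θ, σ (θ + 2 * π) = σ θ + 2 * π := by
    intro θ
    have h1 := hperi.intervalIntegral_add_eq_add 0 θ (fun t₁ t₂ => hci.intervalIntegrable t₁ t₂)
    simp only [zero_add] at h1
    simp only [hσ]
    rw [h1, ← hJ, hcdef]
    field_simp
  have hσ0 : σ 0 = 0 := by simp [hσ]
  have hσn : ∀ n : ℕ, σ (n * (2 * π)) = n * (2 * π) ∧ σ (-(n * (2 * π))) = -(n * (2 * π)) := by
    intro n
    induction n with
    | zero => simp [hσ0]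
    | succ n ih =>
      constructor
      · have := hσper (n * (2 * π))
        rw [ih.1] at this
        push_cast
        rw [show ((n : ℝ) + 1) * (2 * π) = n * (2 * π) + 2 * π by ring, this]
      · have := hσper (-(((n : ℝ) + 1) * (2 * π)))
        rw [show -(((n : ℝ) + 1) * (2 * π)) + 2 * π = -(n * (2 * π)) by ring, ih.2] at this
        push_cast
        linarith
  have hσc : Continuous σ := continuous_iff_continuousAt.2 fun θ => (hσd θ).continuousAt
  have hsurj : Function.Surjective σ := by
    intro t
    obtain ⟨n, hn⟩ := exists_nat_gt (|t| / (2 * π))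
    rw [div_lt_iff₀ hpi] at hn
    have := abs_lt.1 hn
    have himg := intermediate_value_Icc (a := -((n : ℝ) * (2 * π))) (b := n * (2 * π))
      (by linarith) hσc.continuousOn
    rw [(hσn n).1, (hσn n).2] at himg
    obtain ⟨θ, -, hθ⟩ := himg ⟨this.1.le, this.2.le⟩
    exact ⟨θ, hθ⟩
  let e := hmono.orderIsoOfSurjective σ hsurj
  have hσe : ∀ t, σ (e.symm t) = t := fun t => e.apply_symm_apply t
  refine ⟨c, hcpos, e.symm, fun t => ?_, fun t => ?_, e.symm.injective⟩
  · have := HasDerivAt.of_local_left_inverse (f := σ) (g := e.symm) (a := t)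
      e.symm.continuous.continuousAt (hσd (e.symm t)) (hσpos _).ne'
      (Eventually.of_forall hσe)
    simpa [mul_inv, mul_comm] using this
  · apply hmono.injective
    rw [hσe, hσper, hσe]

/-- A periodic solution of the curvature equation written in terms of the tangent angle gives,
after reparametrization by constant hyperbolic speed, an embedded loop. -/
theorem exists_embedded_loop_of_tangentAngle {κ : ℝ × ℝ → ℝ} {x Y : ℝ → ℝ}
    (hκ : Continuous fun θ => κ (x θ, Y θ))
    (hx : ∀ θ, HasDerivAt x (Y θ / (κ (x θ, Y θ) - cos θ) * cos θ) θ)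
    (hY : ∀ θ, HasDerivAt Y (Y θ / (κ (x θ, Y θ) - cos θ) * sin θ) θ)
    (hpx : Function.Periodic x (2 * π)) (hpY : Function.Periodic Y (2 * π))
    (hpos : ∀ θ, 0 < Y θ) (hgt : ∀ θ, cos θ < κ (x θ, Y θ)) :
    ∃ u : ℝ → ℝ × ℝ, IsKLoop κ u ∧ IsEmbedded u := by
  have hgt' : ∀ θ, 0 < κ (x θ, Y θ) - cos θ := fun θ => sub_pos.2 (hgt θ)
  obtain ⟨c, hc, Θ, hΘ, hΘper, hΘinj⟩ := exists_periodic_time_change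
    (h := fun θ => κ (x θ, Y θ) - cos θ) (hκ.sub continuous_cos) hgt'
    (fun θ => by simp only [hpx θ, hpY θ, cos_add_two_pi])
  have hΘc : Continuous Θ := continuous_iff_continuousAt.2 fun t => (hΘ t).continuousAt
  have hYc : Continuous Y := continuous_iff_continuousAt.2 fun t => (hY t).continuousAt
  set u : ℝ → ℝ × ℝ := fun t => (x (Θ t), Y (Θ t)) with hu
  have hu1 : ∀ t, HasDerivAt (fun t => x (Θ t)) (c * Y (Θ t) * cos (Θ t)) t := by
    intro t
    refine ((hx (Θ t)).comp t (hΘ t)).congr_deriv ?_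
    have := (hgt' (Θ t)).ne'
    field_simp
  have hu2 : ∀ t, HasDerivAt (fun t => Y (Θ t)) (c * Y (Θ t) * sin (Θ t)) t := by
    intro t
    refine ((hY (Θ t)).comp t (hΘ t)).congr_deriv ?_
    have := (hgt' (Θ t)).ne'
    field_simp
  have hud : deriv u = fun t => (c * Y (Θ t) * cos (Θ t), c * Y (Θ t) * sin (Θ t)) := by
    funext t
    exact ((hu1 t).prodMk (hu2 t)).deriv
  have hudd : ∀ t, HasDerivAt (deriv u)
      (c * (c * Y (Θ t) * sin (Θ t)) * cos (Θ t) + c * Y (Θ t) *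
        (-sin (Θ t) * (c * (κ (x (Θ t), Y (Θ t)) - cos (Θ t)))),
       c * (c * Y (Θ t) * sin (Θ t)) * sin (Θ t) + c * Y (Θ t) *
        (cos (Θ t) * (c * (κ (x (Θ t), Y (Θ t)) - cos (Θ t))))) t := by
    intro t
    rw [hud]
    exact (((hu2 t).const_mul c).mul (hΘ t).cos).prodMk (((hu2 t).const_mul c).mul (hΘ t).sin)
  have hL : hypL u = c := by
    have : ∀ t, ((deriv u t).1 ^ 2 + (deriv u t).2 ^ 2) / (u t).2 ^ 2 = c ^ 2 := by
      intro t
      rw [hud]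
      have := (hpos (Θ t)).ne'
      simp only [hu]
      field_simp
      linear_combination sin_sq_add_cos_sq (Θ t)
    have hpi := Real.pi_pos.ne'
    simp only [hypL, this, intervalIntegral.integral_const, smul_eq_mul]
    rw [show 1 / (2 * π) * ((2 * π - 0) * c ^ 2) = c ^ 2 by field_simp; ring,
      Real.sqrt_sq hc.le]
  refine ⟨u, ⟨?_, ?_, fun t => hpos _, ?_, ?_⟩, ?_⟩
  · rw [show (2 : WithTop ℕ∞) = 1 + 1 by norm_num, contDiff_succ_iff_deriv]
    refine ⟨fun t => ((hu1 t).prodMk (hu2 t)).differentiableAt, by simp, ?_⟩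
    rw [contDiff_one_iff_deriv]
    refine ⟨fun t => (hudd t).differentiableAt, ?_⟩
    rw [show deriv (deriv u) = _ from funext fun t => (hudd t).deriv]
    have aux : ∀ f : ℝ → ℝ, Continuous f → Continuous fun t =>
        (c * (c * Y (Θ t) * sin (Θ t)) * cos (Θ t) + c * Y (Θ t) *
          (-sin (Θ t) * (c * (f t - cos (Θ t)))),
         c * (c * Y (Θ t) * sin (Θ t)) * sin (Θ t) + c * Y (Θ t) *
          (cos (Θ t) * (c * (f t - cos (Θ t))))) := by
      intro f hf
      fun_prop
    exact aux _ (hκ.comp hΘc)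
  · intro t
    simp only [hu, hΘper, hpx (Θ t), hpY (Θ t)]
  · rintro ⟨p, hp⟩
    have h0 : deriv u 0 = 0 := by
      rw [show u = fun _ => p from funext hp]; simp
    rw [hud] at h0
    have h1 := congrArg Prod.fst h0
    have h2 := congrArg Prod.snd h0
    simp only [Prod.fst_zero, Prod.snd_zero, mul_eq_zero, hc.ne', (hpos (Θ 0)).ne', false_or]
      at h1 h2
    have := sin_sq_add_cos_sq (Θ 0)
    rw [h1, h2] at this
    norm_num at this
  · intro t
    rw [(hudd t).deriv, hL, hud]
    have := (hpos (Θ t)).ne'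
    ext
    · simp only [hu, Gam, rot, Prod.fst_sub, Prod.smul_fst, smul_eq_mul]
      field_simp
      ring
    · simp only [hu, Gam, rot, Prod.snd_sub, Prod.smul_snd, smul_eq_mul]
      field_simp
      ring
  · intro t s hts
    have h1 : x (Θ t) = x (Θ s) := congrArg Prod.fst hts
    have h2 : Y (Θ t) = Y (Θ s) := congrArg Prod.snd hts
    obtain ⟨n, hn⟩ := tangentAngle_injective_mod hx hY
      (fun θ => div_pos (hpos θ) (hgt' θ)) hpx hpY h1 h2
    have hΘp : Function.Periodic (fun t => Θ t - t) (2 * π) := fun t => by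
      simp only [hΘper]; ring
    refine ⟨n, ?_⟩
    have h3 := hΘp.int_mul n s
    have : t = s + n * (2 * π) := hΘinj (by linarith)
    rw [this]; ring

/-- The mean-zero primitive on `[0, 2π]`. -/
def centeredPrimitive (F : ℝ → ℝ × ℝ) (θ : ℝ) : ℝ × ℝ :=
  (∫ τ in (0 : ℝ)..θ, F τ) - (2 * π)⁻¹ • ∫ t in (0 : ℝ)..(2 * π), ∫ τ in (0 : ℝ)..t, F τ

theorem continuous_centeredPrimitive {F : ℝ → ℝ × ℝ} (hF : Continuous F) :
    Continuous (centeredPrimitive F) :=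
  (intervalIntegral.continuous_primitive (fun a b => hF.intervalIntegrable a b) 0).sub
    continuous_const

theorem hasDerivAt_centeredPrimitive {F : ℝ → ℝ × ℝ} (hF : Continuous F) (θ : ℝ) :
    HasDerivAt (centeredPrimitive F) (F θ) θ :=
  (intervalIntegral.integral_hasDerivAt_right (hF.intervalIntegrable _ _)
    (hF.stronglyMeasurableAtFilter _ _) hF.continuousAt).sub_const _

theorem periodic_centeredPrimitive {F : ℝ → ℝ × ℝ} (hF : Continuous F)
    (hp : Function.Periodic F (2 * π)) (h0 : ∫ τ in (0 : ℝ)..(2 * π), F τ = 0) :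
    Function.Periodic (centeredPrimitive F) (2 * π) := by
  intro θ
  have h1 := hp.intervalIntegral_add_eq_add 0 θ (fun t₁ t₂ => hF.intervalIntegrable t₁ t₂)
  simp only [zero_add, h0, add_zero] at h1
  simp only [centeredPrimitive, h1]

theorem integral_centeredPrimitive {F : ℝ → ℝ × ℝ} (hF : Continuous F) :
    ∫ θ in (0 : ℝ)..(2 * π), centeredPrimitive F θ = 0 := by
  have hc : Continuous fun t => ∫ τ in (0 : ℝ)..t, F τ :=
    intervalIntegral.continuous_primitive (fun a b => hF.intervalIntegrable a b) 0
  simp only [centeredPrimitive]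
  rw [intervalIntegral.integral_sub (hc.intervalIntegrable _ _) (by simp),
    intervalIntegral.integral_const, sub_zero, smul_smul,
    mul_inv_cancel₀ Real.two_pi_pos.ne', one_smul, sub_self]

theorem norm_centeredPrimitive_sub_le {F F' : ℝ → ℝ × ℝ} (hF : Continuous F)
    (hF' : Continuous F') {M : ℝ} (hM : ∀ τ, ‖F τ - F' τ‖ ≤ M) {θ : ℝ}
    (hθ : θ ∈ Set.Icc 0 (2 * π)) :
    ‖centeredPrimitive F θ - centeredPrimitive F' θ‖ ≤ 4 * π * M := by
  have hpi := Real.two_pi_pos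
  have hM0 : 0 ≤ M := (norm_nonneg _).trans (hM 0)
  have hc : Continuous fun t => ∫ τ in (0 : ℝ)..t, F τ :=
    intervalIntegral.continuous_primitive (fun a b => hF.intervalIntegrable a b) 0
  have hc' : Continuous fun t => ∫ τ in (0 : ℝ)..t, F' τ :=
    intervalIntegral.continuous_primitive (fun a b => hF'.intervalIntegrable a b) 0
  have h1 : ∀ t ∈ Set.Icc 0 (2 * π),
      ‖(∫ τ in (0 : ℝ)..t, F τ) - ∫ τ in (0 : ℝ)..t, F' τ‖ ≤ 2 * π * M := by
    intro t ht
    rw [← intervalIntegral.integral_sub (hF.intervalIntegrable _ _) (hF'.intervalIntegrable _ _)]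
    refine (intervalIntegral.norm_integral_le_of_norm_le_const fun τ _ => hM τ).trans ?_
    rw [sub_zero, abs_of_nonneg ht.1, mul_comm]
    exact mul_le_mul_of_nonneg_right ht.2 hM0
  have h2 : ‖(∫ t in (0 : ℝ)..(2 * π), ∫ τ in (0 : ℝ)..t, F τ) -
      ∫ t in (0 : ℝ)..(2 * π), ∫ τ in (0 : ℝ)..t, F' τ‖ ≤ 2 * π * M * (2 * π) := by
    rw [← intervalIntegral.integral_sub (hc.intervalIntegrable _ _) (hc'.intervalIntegrable _ _)]
    refine (intervalIntegral.norm_integral_le_of_norm_le_const fun t ht => h1 t ?_).trans ?_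
    · rw [Set.uIoc_of_le hpi.le] at ht
      exact ⟨ht.1.le, ht.2⟩
    · rw [sub_zero, abs_of_pos hpi]
  have h3 : centeredPrimitive F θ - centeredPrimitive F' θ =
      ((∫ τ in (0 : ℝ)..θ, F τ) - ∫ τ in (0 : ℝ)..θ, F' τ) - (2 * π)⁻¹ •
      ((∫ t in (0 : ℝ)..(2 * π), ∫ τ in (0 : ℝ)..t, F τ) -
      ∫ t in (0 : ℝ)..(2 * π), ∫ τ in (0 : ℝ)..t, F' τ) := by
    simp only [centeredPrimitive, smul_sub]; abel
  rw [h3]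
  refine (norm_sub_le _ _).trans ?_
  rw [norm_smul, Real.norm_of_nonneg (inv_nonneg.2 hpi.le)]
  have h4 : (2 * π)⁻¹ * ‖(∫ t in (0 : ℝ)..(2 * π), ∫ τ in (0 : ℝ)..t, F τ) -
      ∫ t in (0 : ℝ)..(2 * π), ∫ τ in (0 : ℝ)..t, F' τ‖ ≤ 2 * π * M := by
    rw [inv_mul_le_iff₀ hpi]
    linarith
  linarith [h1 θ hθ]

/-- Uniform bounds for a periodic drift `g` and a periodic positive weight `s` on the plane. -/
structure TameData (B L s₀ : ℝ) (g : ℝ → ℝ × ℝ → ℝ × ℝ) (s : ℝ → ℝ × ℝ → ℝ) : Prop where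
  cont_g : Continuous (Function.uncurry g)
  cont_s : Continuous (Function.uncurry s)
  per_g : ∀ θ w, g (θ + 2 * π) w = g θ w
  per_s : ∀ θ w, s (θ + 2 * π) w = s θ w
  bound_g : ∀ θ w, ‖g θ w‖ ≤ B
  bound_s : ∀ θ w, |s θ w| ≤ B
  lower_s : ∀ θ w, s₀ ≤ s θ w
  lip_g : ∀ θ w w', ‖g θ w - g θ w'‖ ≤ L * ‖w - w'‖
  lip_s : ∀ θ w w', |s θ w - s θ w'| ≤ L * ‖w - w'‖

/-- The multiplier `(∫ s)⁻¹ ∫ g` along a path. -/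
def multiplier (g : ℝ → ℝ × ℝ → ℝ × ℝ) (s : ℝ → ℝ × ℝ → ℝ) (w : ℝ → ℝ × ℝ) : ℝ × ℝ :=
  (∫ θ in (0 : ℝ)..(2 * π), s θ (w θ))⁻¹ • ∫ θ in (0 : ℝ)..(2 * π), g θ (w θ)

/-- The drift corrected by the multiplier, so that it has mean zero. -/
def balancedDrift (g : ℝ → ℝ × ℝ → ℝ × ℝ) (s : ℝ → ℝ × ℝ → ℝ) (w : ℝ → ℝ × ℝ) (θ : ℝ) : ℝ × ℝ :=
  g θ (w θ) - s θ (w θ) • multiplier g s w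

section Tame

variable {B L s₀ : ℝ} {g : ℝ → ℝ × ℝ → ℝ × ℝ} {s : ℝ → ℝ × ℝ → ℝ}

theorem TameData.continuous_g_comp (h : TameData B L s₀ g s) {w : ℝ → ℝ × ℝ} (hw : Continuous w) :
    Continuous fun θ => g θ (w θ) :=
  h.cont_g.comp (continuous_id.prodMk hw)

theorem TameData.continuous_s_comp (h : TameData B L s₀ g s) {w : ℝ → ℝ × ℝ} (hw : Continuous w) :
    Continuous fun θ => s θ (w θ) :=
  h.cont_s.comp (continuous_id.prodMk hw)

theorem TameData.continuous_balancedDrift (h : TameData B L s₀ g s) {w : ℝ → ℝ × ℝ}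
    (hw : Continuous w) : Continuous (balancedDrift g s w) :=
  (h.continuous_g_comp hw).sub ((h.continuous_s_comp hw).smul continuous_const)

theorem TameData.le_integral_s (h : TameData B L s₀ g s) {w : ℝ → ℝ × ℝ} (hw : Continuous w) :
    2 * π * s₀ ≤ ∫ θ in (0 : ℝ)..(2 * π), s θ (w θ) := by
  have := intervalIntegral.integral_mono_on (μ := volume) Real.two_pi_pos.le
    (intervalIntegrable_const (c := s₀)) ((h.continuous_s_comp hw).intervalIntegrable 0 (2 * π))
    (fun θ _ => h.lower_s θ (w θ))
  simpa using this

theorem TameData.norm_integral_g_le (h : TameData B L s₀ g s) (w : ℝ → ℝ × ℝ) :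
    ‖∫ θ in (0 : ℝ)..(2 * π), g θ (w θ)‖ ≤ 2 * π * B := by
  refine (intervalIntegral.norm_integral_le_of_norm_le_const fun θ _ => h.bound_g θ _).trans ?_
  rw [sub_zero, abs_of_pos Real.two_pi_pos, mul_comm]

theorem TameData.norm_multiplier_le (h : TameData B L s₀ g s) (hs₀ : 0 < s₀) {w : ℝ → ℝ × ℝ}
    (hw : Continuous w) : ‖multiplier g s w‖ ≤ B / s₀ := by
  have hpi := Real.two_pi_pos
  have h1 := h.le_integral_s hw
  have h2 : 0 < 2 * π * s₀ := by positivity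
  rw [multiplier, norm_smul, norm_inv, Real.norm_of_nonneg (h2.trans_le h1).le]
  rw [inv_mul_le_iff₀ (h2.trans_le h1)]
  have hB : 0 ≤ B := (norm_nonneg _).trans (h.bound_g 0 0)
  calc _ ≤ 2 * π * B := h.norm_integral_g_le w
    _ = 2 * π * s₀ * (B / s₀) := by field_simp
    _ ≤ _ := by gcongr

theorem TameData.norm_multiplier_sub_multiplier_le {g' : ℝ → ℝ × ℝ → ℝ × ℝ}
    {s' : ℝ → ℝ × ℝ → ℝ} (h : TameData B L s₀ g s) (h' : TameData B L s₀ g' s') (hs₀ : 0 < s₀)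
    {w w' : ℝ → ℝ × ℝ} (hw : Continuous w) (hw' : Continuous w') {e : ℝ}
    (hg : ∀ θ, ‖g θ (w θ) - g' θ (w' θ)‖ ≤ e) (hs : ∀ θ, |s θ (w θ) - s' θ (w' θ)| ≤ e) :
    ‖multiplier g s w - multiplier g' s' w'‖ ≤ (1 / s₀ + B / s₀ ^ 2) * e := by
  have hpi := Real.two_pi_pos
  have he0 : 0 ≤ e := (norm_nonneg _).trans (hg 0)
  have hB : 0 ≤ B := (norm_nonneg _).trans (h.bound_g 0 0)
  have h2 : 0 < 2 * π * s₀ := by positivity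
  have hS := h.le_integral_s hw
  have hS' := h'.le_integral_s hw'
  have hN' := h'.norm_integral_g_le w'
  have hdN : ‖(∫ θ in (0 : ℝ)..(2 * π), g θ (w θ)) - ∫ θ in (0 : ℝ)..(2 * π), g' θ (w' θ)‖
      ≤ 2 * π * e := by
    rw [← intervalIntegral.integral_sub ((h.continuous_g_comp hw).intervalIntegrable _ _)
      ((h'.continuous_g_comp hw').intervalIntegrable _ _)]
    refine (intervalIntegral.norm_integral_le_of_norm_le_const fun θ _ => hg θ).trans ?_
    rw [sub_zero, abs_of_pos hpi, mul_comm]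
  have hdS : |(∫ θ in (0 : ℝ)..(2 * π), s θ (w θ)) - ∫ θ in (0 : ℝ)..(2 * π), s' θ (w' θ)|
      ≤ 2 * π * e := by
    rw [← intervalIntegral.integral_sub ((h.continuous_s_comp hw).intervalIntegrable _ _)
      ((h'.continuous_s_comp hw').intervalIntegrable _ _), ← Real.norm_eq_abs]
    refine (intervalIntegral.norm_integral_le_of_norm_le_const fun θ _ => hs θ).trans ?_
    rw [sub_zero, abs_of_pos hpi, mul_comm]
  simp only [multiplier]
  set N := ∫ θ in (0 : ℝ)..(2 * π), g θ (w θ)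
  set N' := ∫ θ in (0 : ℝ)..(2 * π), g' θ (w' θ)
  set S := ∫ θ in (0 : ℝ)..(2 * π), s θ (w θ)
  set S' := ∫ θ in (0 : ℝ)..(2 * π), s' θ (w' θ)
  have hSp : 0 < S := h2.trans_le hS
  have hSp' : 0 < S' := h2.trans_le hS'
  have hsplit : S⁻¹ • N - S'⁻¹ • N' = S⁻¹ • (N - N') - ((S - S') * (S⁻¹ * S'⁻¹)) • N' := by
    have : (S - S') * (S⁻¹ * S'⁻¹) = S'⁻¹ - S⁻¹ := by field_simp
    rw [this, smul_sub, sub_smul]; abel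
  rw [hsplit]
  refine (norm_sub_le _ _).trans ?_
  rw [norm_smul, norm_smul, norm_mul, norm_mul, norm_inv, norm_inv,
    Real.norm_of_nonneg hSp.le, Real.norm_of_nonneg hSp'.le, Real.norm_eq_abs]
  have hi : S⁻¹ ≤ (2 * π * s₀)⁻¹ := inv_anti₀ h2 hS
  have hi' : S'⁻¹ ≤ (2 * π * s₀)⁻¹ := inv_anti₀ h2 hS'
  calc S⁻¹ * ‖N - N'‖ + |S - S'| * (S⁻¹ * S'⁻¹) * ‖N'‖
      ≤ (2 * π * s₀)⁻¹ * (2 * π * e) +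
        2 * π * e * ((2 * π * s₀)⁻¹ * (2 * π * s₀)⁻¹) * (2 * π * B) := by
        gcongr
    _ = (1 / s₀ + B / s₀ ^ 2) * e := by field_simp

theorem TameData.norm_multiplier_sub_le (h : TameData B L s₀ g s) (hs₀ : 0 < s₀) (hL : 0 ≤ L)
    {w w' : ℝ → ℝ × ℝ} (hw : Continuous w) (hw' : Continuous w') {d : ℝ}
    (hd : ∀ θ, ‖w θ - w' θ‖ ≤ d) :
    ‖multiplier g s w - multiplier g s w'‖ ≤ (L / s₀ + L * B / s₀ ^ 2) * d := by
  refine (h.norm_multiplier_sub_multiplier_le h hs₀ hw hw' (e := L * d)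
    (fun θ => (h.lip_g θ _ _).trans (mul_le_mul_of_nonneg_left (hd θ) hL))
    (fun θ => (h.lip_s θ _ _).trans (mul_le_mul_of_nonneg_left (hd θ) hL))).trans_eq ?_
  ring

theorem TameData.norm_balancedDrift_le (h : TameData B L s₀ g s) (hs₀ : 0 < s₀)
    {w : ℝ → ℝ × ℝ} (hw : Continuous w) (θ : ℝ) :
    ‖balancedDrift g s w θ‖ ≤ B + B * (B / s₀) := by
  have hB : 0 ≤ B := (norm_nonneg _).trans (h.bound_g 0 0)
  refine (norm_sub_le _ _).trans ?_
  rw [norm_smul]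
  exact add_le_add (h.bound_g _ _) (mul_le_mul (h.bound_s _ _) (h.norm_multiplier_le hs₀ hw)
    (norm_nonneg _) hB)

theorem TameData.norm_balancedDrift_sub_le (h : TameData B L s₀ g s) (hs₀ : 0 < s₀) (hL : 0 ≤ L)
    {w w' : ℝ → ℝ × ℝ} (hw : Continuous w) (hw' : Continuous w') {d : ℝ}
    (hd : ∀ θ, ‖w θ - w' θ‖ ≤ d) (θ : ℝ) :
    ‖balancedDrift g s w θ - balancedDrift g s w' θ‖ ≤
      (L + L * (B / s₀) + B * (L / s₀ + L * B / s₀ ^ 2)) * d := by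
  have hB : 0 ≤ B := (norm_nonneg _).trans (h.bound_g 0 0)
  have hd0 : 0 ≤ d := (norm_nonneg _).trans (hd 0)
  have e : balancedDrift g s w θ - balancedDrift g s w' θ =
      (g θ (w θ) - g θ (w' θ)) - (s θ (w θ) - s θ (w' θ)) • multiplier g s w
        - s θ (w' θ) • (multiplier g s w - multiplier g s w') := by
    simp only [balancedDrift, smul_sub, sub_smul]; abel
  rw [e]
  have h1 : ‖g θ (w θ) - g θ (w' θ)‖ ≤ L * d :=
    (h.lip_g θ _ _).trans (mul_le_mul_of_nonneg_left (hd θ) hL)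
  have h2 : ‖(s θ (w θ) - s θ (w' θ)) • multiplier g s w‖ ≤ L * d * (B / s₀) := by
    rw [norm_smul]
    exact mul_le_mul ((h.lip_s θ _ _).trans (mul_le_mul_of_nonneg_left (hd θ) hL))
      (h.norm_multiplier_le hs₀ hw) (norm_nonneg _) (by positivity)
  have h3 : ‖s θ (w' θ) • (multiplier g s w - multiplier g s w')‖ ≤
      B * ((L / s₀ + L * B / s₀ ^ 2) * d) := by
    rw [norm_smul]
    exact mul_le_mul (h.bound_s _ _) (h.norm_multiplier_sub_le hs₀ hL hw hw' hd)
      (norm_nonneg _) hB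
  calc _ ≤ _ := (norm_sub_le _ _).trans (add_le_add_left (norm_sub_le _ _) _)
    _ ≤ L * d + L * d * (B / s₀) + B * ((L / s₀ + L * B / s₀ ^ 2) * d) := by gcongr
    _ = _ := by ring

theorem TameData.integral_balancedDrift (h : TameData B L s₀ g s) (hs₀ : 0 < s₀)
    {w : ℝ → ℝ × ℝ} (hw : Continuous w) :
    ∫ θ in (0 : ℝ)..(2 * π), balancedDrift g s w θ = 0 := by
  have hpi := Real.two_pi_pos
  have h2 : 0 < 2 * π * s₀ := by positivity
  have hi : Continuous fun θ => s θ (w θ) • multiplier g s w :=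
    (h.continuous_s_comp hw).smul continuous_const
  simp only [balancedDrift]
  rw [intervalIntegral.integral_sub ((h.continuous_g_comp hw).intervalIntegrable _ _)
    (hi.intervalIntegrable _ _),
    intervalIntegral.integral_smul_const, multiplier, smul_smul,
    mul_inv_cancel₀ (h2.trans_le (h.le_integral_s hw)).ne', one_smul, sub_self]

theorem TameData.periodic_balancedDrift (h : TameData B L s₀ g s) {w : ℝ → ℝ × ℝ}
    (hw : Function.Periodic w (2 * π)) : Function.Periodic (balancedDrift g s w) (2 * π) := by
  intro θ
  simp only [balancedDrift, hw θ, h.per_g, h.per_s]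

/-- For a small parameter, every prescribed mean value `z` is the mean of exactly one small
periodic solution of the balanced equation `W' = η (g - s ν)`; it depends on `z` in a Lipschitz
way. -/
theorem TameData.exists_balanced_solutions (hs₀ : 0 < s₀) (hL : 0 ≤ L) (hB : 0 ≤ B) :
    ∃ C > (0 : ℝ), ∀ (g : ℝ → ℝ × ℝ → ℝ × ℝ) (s : ℝ → ℝ × ℝ → ℝ), TameData B L s₀ g s →
      ∀ η : ℝ, C * |η| ≤ 1 / 2 → ∃ W : ℝ × ℝ → ℝ → ℝ × ℝ,
        (∀ z, Function.Periodic (W z) (2 * π)) ∧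
        (∀ z θ, HasDerivAt (W z) (η • balancedDrift g s (W z) θ) θ) ∧
        (∀ z, ∫ θ in (0 : ℝ)..(2 * π), W z θ = (2 * π) • z) ∧
        (∀ z θ, ‖W z θ - z‖ ≤ C * |η|) ∧
        (∀ z z' θ, ‖W z θ - W z' θ‖ ≤ 2 * ‖z - z'‖) := by
  have hpi := Real.two_pi_pos
  have : Fact (0 < 2 * π) := ⟨hpi⟩
  set M₁ := B + B * (B / s₀) with hM₁
  set M₂ := L + L * (B / s₀) + B * (L / s₀ + L * B / s₀ ^ 2) with hM₂
  have hM₁0 : 0 ≤ M₁ := by positivity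
  have hM₂0 : 0 ≤ M₂ := by positivity
  refine ⟨4 * π * (M₁ + M₂) + 1, by positivity, fun g s h η hη => ?_⟩
  set C := 4 * π * (M₁ + M₂) + 1 with hC
  have hcoe : ∀ w : C(AddCircle (2 * π), ℝ × ℝ), Continuous fun θ : ℝ => w (θ : AddCircle (2 * π)) :=
    fun w => w.continuous.comp (AddCircle.continuous_mk' _)
  have hcoep : ∀ w : C(AddCircle (2 * π), ℝ × ℝ),
      Function.Periodic (fun θ : ℝ => w (θ : AddCircle (2 * π))) (2 * π) :=
    fun w θ => by simp
  let D : C(AddCircle (2 * π), ℝ × ℝ) → ℝ → ℝ × ℝ := fun w =>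
    balancedDrift g s fun θ : ℝ => w (θ : AddCircle (2 * π))
  have hD : ∀ w, Continuous (D w) := fun w => h.continuous_balancedDrift (hcoe w)
  have hDp : ∀ w, Function.Periodic (centeredPrimitive (D w)) (2 * π) := fun w =>
    periodic_centeredPrimitive (hD w) (h.periodic_balancedDrift (hcoep w))
      (h.integral_balancedDrift hs₀ (hcoe w))
  let Ψ : C(AddCircle (2 * π), ℝ × ℝ) → C(AddCircle (2 * π), ℝ × ℝ) := fun w =>
    ⟨(hDp w).lift, (continuous_centeredPrimitive (hD w)).quotient_lift _⟩
  have hΨ : ∀ w (θ : ℝ), Ψ w (θ : AddCircle (2 * π)) = centeredPrimitive (D w) θ := fun w θ => rfl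
  have hrep : ∀ x : AddCircle (2 * π), ∃ θ ∈ Set.Icc 0 (2 * π), (θ : AddCircle (2 * π)) = x := by
    intro x
    obtain ⟨θ, hθ, rfl⟩ := AddCircle.eq_coe_Ico x
    exact ⟨θ, ⟨hθ.1, hθ.2.le⟩, rfl⟩
  have hΨb : ∀ w x, ‖Ψ w x‖ ≤ C := by
    intro w x
    obtain ⟨θ, hθ, rfl⟩ := hrep x
    rw [hΨ]
    have h0 : centeredPrimitive (fun _ => (0 : ℝ × ℝ)) θ = 0 := by simp [centeredPrimitive]
    have := norm_centeredPrimitive_sub_le (hD w) (continuous_const (y := (0 : ℝ × ℝ)))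
      (M := M₁) (fun τ => by simpa using h.norm_balancedDrift_le hs₀ (hcoe w) τ) hθ
    rw [h0, sub_zero] at this
    nlinarith
  have hΨl : ∀ w w', ‖Ψ w - Ψ w'‖ ≤ C * ‖w - w'‖ := by
    intro w w'
    rw [ContinuousMap.norm_le _ (by positivity)]
    intro x
    obtain ⟨θ, hθ, rfl⟩ := hrep x
    rw [ContinuousMap.sub_apply, hΨ, hΨ]
    refine (norm_centeredPrimitive_sub_le (hD w) (hD w') (fun τ =>
      h.norm_balancedDrift_sub_le hs₀ hL (hcoe w) (hcoe w') (d := ‖w - w'‖)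
        (fun θ => (w - w').norm_coe_le_norm _) τ) hθ).trans ?_
    have := norm_nonneg (w - w')
    rw [← hM₂, hC, ← mul_assoc]
    apply mul_le_mul_of_nonneg_right _ this
    nlinarith
  let T : ℝ × ℝ → C(AddCircle (2 * π), ℝ × ℝ) → C(AddCircle (2 * π), ℝ × ℝ) := fun z w =>
    ContinuousMap.const _ z + η • Ψ w
  have hT : ∀ z, ContractingWith (1 / 2) (T z) := by
    intro z
    refine ⟨by rw [← NNReal.coe_lt_coe]; norm_num, LipschitzWith.of_dist_le_mul fun w w' => ?_⟩
    have e : T z w - T z w' = η • (Ψ w - Ψ w') := by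
      simp only [T, smul_sub]; abel
    rw [dist_eq_norm, dist_eq_norm, e, norm_smul, Real.norm_eq_abs]
    have := mul_le_mul_of_nonneg_left (hΨl w w') (abs_nonneg η)
    have h3 := mul_le_mul_of_nonneg_right hη (norm_nonneg (w - w'))
    push_cast
    linarith
  let V : ℝ × ℝ → C(AddCircle (2 * π), ℝ × ℝ) := fun z => (hT z).fixedPoint
  have hV : ∀ z, V z = ContinuousMap.const _ z + η • Ψ (V z) := fun z =>
    ((hT z).fixedPoint_isFixedPt).symm
  have hVθ : ∀ z (θ : ℝ), V z (θ : AddCircle (2 * π)) = z + η • centeredPrimitive (D (V z)) θ := by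
    intro z θ
    conv_lhs => rw [hV z]
    simp [hΨ]
  refine ⟨fun z θ => V z (θ : AddCircle (2 * π)), fun z => hcoep (V z), fun z θ => ?_, fun z => ?_,
    fun z θ => ?_, fun z z' θ => ?_⟩
  · exact (((hasDerivAt_centeredPrimitive (hD (V z)) θ).const_smul η).const_add z).congr_of_eventuallyEq
      (Eventually.of_forall (hVθ z))
  · have hi : Continuous fun θ => η • centeredPrimitive (D (V z)) θ :=
      (continuous_centeredPrimitive (hD (V z))).const_smul η
    simp only [hVθ]
    rw [intervalIntegral.integral_add intervalIntegrable_const (hi.intervalIntegrable _ _),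
      intervalIntegral.integral_smul, integral_centeredPrimitive (hD (V z))]
    simp
  · beta_reduce
    rw [hVθ, add_sub_cancel_left, norm_smul, Real.norm_eq_abs, mul_comm, ← hΨ]
    exact mul_le_mul_of_nonneg_right (hΨb _ _) (abs_nonneg η)
  · have h1 : ‖V z - V z'‖ ≤ ‖z - z'‖ + 1 / 2 * ‖V z - V z'‖ := by
      have e : V z - V z' = ContinuousMap.const _ (z - z') + η • (Ψ (V z) - Ψ (V z')) := by
        conv_lhs => rw [hV z, hV z']
        ext1 x
        simp only [ContinuousMap.sub_apply, ContinuousMap.add_apply, ContinuousMap.smul_apply,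
          ContinuousMap.const_apply, smul_sub]
        abel
      conv_lhs => rw [e]
      refine (norm_add_le _ _).trans (add_le_add ?_ ?_)
      · rw [ContinuousMap.norm_le _ (norm_nonneg _)]
        exact fun x => le_rfl
      · rw [norm_smul, Real.norm_eq_abs]
        have := mul_le_mul_of_nonneg_left (hΨl (V z) (V z')) (abs_nonneg η)
        have h3 := mul_le_mul_of_nonneg_right hη (norm_nonneg (V z - V z'))
        linarith
    have h2 := (V z - V z').norm_coe_le_norm (θ : AddCircle (2 * π))
    rw [ContinuousMap.sub_apply] at h2
    linarith

end Tame

/-- The primitive of `κ` in the vertical direction. -/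
def vertPrim (κ : ℝ × ℝ → ℝ) (x Y : ℝ) : ℝ := ∫ t in (0 : ℝ)..Y, κ (x, t)

/-- The primitive of `κ` in the horizontal direction. -/
def horPrim (κ : ℝ × ℝ → ℝ) (x Y : ℝ) : ℝ := ∫ ξ in (0 : ℝ)..x, κ (ξ, Y)

/-- A function with mixed second derivative `κ`. -/
def doublePrim (κ : ℝ × ℝ → ℝ) (x Y : ℝ) : ℝ := ∫ ξ in (0 : ℝ)..x, vertPrim κ ξ Y

section Primitives

variable {κ : ℝ × ℝ → ℝ}

theorem continuous_vertPrim (hκ : Continuous κ) :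
    Continuous fun p : ℝ × ℝ => vertPrim κ p.1 p.2 :=
  intervalIntegral.continuous_parametric_intervalIntegral_of_continuous
    (f := fun (p : ℝ × ℝ) t => κ (p.1, t)) (by fun_prop) continuous_snd

theorem continuous_horPrim (hκ : Continuous κ) :
    Continuous fun p : ℝ × ℝ => horPrim κ p.1 p.2 :=
  intervalIntegral.continuous_parametric_intervalIntegral_of_continuous
    (f := fun (p : ℝ × ℝ) ξ => κ (ξ, p.2)) (by fun_prop) continuous_fst

theorem doublePrim_eq (hκ : Continuous κ) (x Y : ℝ) :
    doublePrim κ x Y = ∫ t in (0 : ℝ)..Y, horPrim κ x t := by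
  refine intervalIntegral_intervalIntegral_swap (F := fun ξ t => κ (ξ, t)) ?_
  have hc : Continuous (Function.uncurry fun ξ t => κ (ξ, t)) := by fun_prop
  exact (hc.continuousOn.integrableOn_compact (isCompact_uIcc.prod isCompact_uIcc)).mono_set
    (Set.prod_mono Set.uIoc_subset_uIcc Set.uIoc_subset_uIcc)

theorem hasDerivAt_doublePrim (hκ : Continuous κ) {x Y : ℝ → ℝ} {x' Y' θ : ℝ}
    (hx : HasDerivAt x x' θ) (hY : HasDerivAt Y Y' θ) :
    HasDerivAt (fun τ => doublePrim κ (x τ) (Y τ))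
      (vertPrim κ (x θ) (Y θ) * x' + horPrim κ (x θ) (Y θ) * Y') θ := by
  have hv := continuous_vertPrim hκ
  have hh := continuous_horPrim hκ
  have h := hasStrictFDerivAt_uncurry_coprod (𝕜 := ℝ) (u := (x θ, Y θ)) (f := doublePrim κ)
    (f₁ := fun a b => ContinuousLinearMap.toSpanSingleton ℝ (vertPrim κ a b))
    (f₂ := fun a b => ContinuousLinearMap.toSpanSingleton ℝ (horPrim κ a b))
    (Eventually.of_forall fun v => by
      have hc : Continuous fun ξ => vertPrim κ ξ v.2 := hv.comp (by fun_prop : Continuous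
        fun ξ : ℝ => (ξ, v.2))
      exact (intervalIntegral.integral_hasDerivAt_right (hc.intervalIntegrable _ _)
        (hc.stronglyMeasurableAtFilter _ _) hc.continuousAt).hasFDerivAt)
    (Eventually.of_forall fun v => by
      have hc : Continuous fun t => horPrim κ v.1 t := hh.comp (by fun_prop : Continuous
        fun t : ℝ => (v.1, t))
      exact ((intervalIntegral.integral_hasDerivAt_right (hc.intervalIntegrable _ _)
        (hc.stronglyMeasurableAtFilter _ _) hc.continuousAt).congr_of_eventuallyEq
        (Eventually.of_forall (doublePrim_eq hκ v.1))).hasFDerivAt)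
    (((ContinuousLinearMap.toSpanSingletonCLE (𝕜 := ℝ) (E := ℝ)).continuous.comp hv).continuousAt)
    (((ContinuousLinearMap.toSpanSingletonCLE (𝕜 := ℝ) (E := ℝ)).continuous.comp hh).continuousAt)
  have := h.hasFDerivAt.comp_hasDerivAt θ (hx.prodMk hY)
  refine this.congr_deriv ?_
  simp [Function.HasUncurry.uncurry]
  ring

theorem abs_integral_sub_mul_le {f : ℝ → ℝ} (hf : Continuous f) {a b c M : ℝ}
    (h : ∀ t ∈ Set.uIcc a b, |f t - c| ≤ M) :
    |(∫ t in a..b, f t) - c * (b - a)| ≤ M * |b - a| := by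
  have e : (∫ t in a..b, f t) - c * (b - a) = ∫ t in a..b, (f t - c) := by
    rw [intervalIntegral.integral_sub (hf.intervalIntegrable _ _) intervalIntegrable_const]
    simp [mul_comm]
  rw [e, ← Real.norm_eq_abs]
  exact intervalIntegral.norm_integral_le_of_norm_le_const fun t ht =>
    h t (Set.uIoc_subset_uIcc ht)

theorem abs_integral_sub_sub_sub_le {f₁ f₂ f₃ f₄ : ℝ → ℝ} (h₁ : Continuous f₁)
    (h₂ : Continuous f₂) (h₃ : Continuous f₃) (h₄ : Continuous f₄) {C : ℝ}
    (h : ∀ θ, |f₁ θ - f₂ θ - f₃ θ - f₄ θ| ≤ C) :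
    |(∫ θ in (0 : ℝ)..(2 * π), f₁ θ) - (∫ θ in (0 : ℝ)..(2 * π), f₂ θ) -
      (∫ θ in (0 : ℝ)..(2 * π), f₃ θ) - ∫ θ in (0 : ℝ)..(2 * π), f₄ θ| ≤ 2 * π * C := by
  have h₁₂ : Continuous fun θ => f₁ θ - f₂ θ := h₁.sub h₂
  have h₁₃ : Continuous fun θ => f₁ θ - f₂ θ - f₃ θ := h₁₂.sub h₃
  rw [← intervalIntegral.integral_sub (h₁.intervalIntegrable _ _) (h₂.intervalIntegrable _ _),
    ← intervalIntegral.integral_sub (h₁₂.intervalIntegrable _ _) (h₃.intervalIntegrable _ _),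
    ← intervalIntegral.integral_sub (h₁₃.intervalIntegrable _ _) (h₄.intervalIntegrable _ _),
    ← Real.norm_eq_abs]
  refine (intervalIntegral.norm_integral_le_of_norm_le_const fun θ _ => h θ).trans ?_
  rw [sub_zero, abs_of_pos Real.two_pi_pos, mul_comm]

theorem vertPrim_sub (hκ : Continuous κ) (x Y Y' : ℝ) :
    vertPrim κ x Y' - vertPrim κ x Y = ∫ t in Y..Y', κ (x, t) := by
  have hc : Continuous fun t => κ (x, t) := by fun_prop
  exact intervalIntegral.integral_interval_sub_left (hc.intervalIntegrable _ _)
    (hc.intervalIntegrable _ _)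

theorem abs_vertPrim_sub_le (hκ : Continuous κ) {B : ℝ} (hB : ∀ p, |κ p| ≤ B) (x Y Y' : ℝ) :
    |vertPrim κ x Y' - vertPrim κ x Y| ≤ B * |Y' - Y| := by
  rw [vertPrim_sub hκ, ← Real.norm_eq_abs]
  exact intervalIntegral.norm_integral_le_of_norm_le_const fun t _ => hB _

theorem abs_vertPrim_sub_sub_le (hκ : Continuous κ) {L : ℝ}
    (hL : ∀ p p', |κ p - κ p'| ≤ L * ‖p - p'‖) (hL0 : 0 ≤ L) (p p' : ℝ × ℝ) :
    |vertPrim κ p'.1 p'.2 - vertPrim κ p'.1 p.2 - κ p * (p'.2 - p.2)| ≤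
      L * ‖p' - p‖ * |p'.2 - p.2| := by
  rw [vertPrim_sub hκ]
  refine abs_integral_sub_mul_le (by fun_prop) fun t ht => (hL _ _).trans ?_
  refine mul_le_mul_of_nonneg_left ?_ hL0
  simp only [Prod.norm_def, Prod.fst_sub, Prod.snd_sub, Real.norm_eq_abs]
  exact max_le_max le_rfl (Set.abs_sub_left_of_mem_uIcc ht)

theorem abs_horPrim_sub_sub_le (hκ : Continuous κ) {L : ℝ}
    (hL : ∀ p p', |κ p - κ p'| ≤ L * ‖p - p'‖) (hL0 : 0 ≤ L) (p : ℝ × ℝ) (x' : ℝ) :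
    |horPrim κ x' p.2 - horPrim κ p.1 p.2 - κ p * (x' - p.1)| ≤
      L * |x' - p.1| * |x' - p.1| := by
  have hc : Continuous fun ξ => κ (ξ, p.2) := by fun_prop
  have e : horPrim κ x' p.2 - horPrim κ p.1 p.2 = ∫ ξ in p.1..x', κ (ξ, p.2) :=
    intervalIntegral.integral_interval_sub_left (hc.intervalIntegrable _ _)
      (hc.intervalIntegrable _ _)
  rw [e]
  refine abs_integral_sub_mul_le hc fun t ht => (hL _ _).trans ?_
  refine mul_le_mul_of_nonneg_left ?_ hL0
  simp only [Prod.norm_def, Prod.fst_sub, Prod.snd_sub, Real.norm_eq_abs, sub_self, abs_zero]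
  exact max_le (Set.abs_sub_left_of_mem_uIcc ht) (abs_nonneg _)

/-- First-order expansion of the integral of the one-form `q dx`, `∂q/∂Y = κ`, along closed
curves. -/
theorem abs_integral_vertPrim_sub_le (hκ : Continuous κ) {B L M d : ℝ} (hB : ∀ p, |κ p| ≤ B)
    (hL : ∀ p p', |κ p - κ p'| ≤ L * ‖p - p'‖) (hL0 : 0 ≤ L) {p p' q q' : ℝ → ℝ × ℝ}
    (hp : ∀ θ, HasDerivAt p (p' θ) θ) (hq : ∀ θ, HasDerivAt q (q' θ) θ)
    (hp' : Continuous p') (hq' : Continuous q') (hpp : Function.Periodic p (2 * π))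
    (hqp : Function.Periodic q (2 * π)) (hM : ∀ θ, ‖p' θ‖ ≤ M)
    (hd : ∀ θ, ‖q θ - p θ‖ ≤ d) (hd' : ∀ θ, ‖q' θ - p' θ‖ ≤ d) :
    |(∫ θ in (0 : ℝ)..(2 * π), vertPrim κ (q θ).1 (q θ).2 * (q' θ).1) -
      (∫ θ in (0 : ℝ)..(2 * π), vertPrim κ (p θ).1 (p θ).2 * (p' θ).1) -
      ∫ θ in (0 : ℝ)..(2 * π), κ (p θ) *
        ((q θ - p θ).2 * (p' θ).1 - (q θ - p θ).1 * (p' θ).2)| ≤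
      2 * π * ((B + 2 * L * M) * d ^ 2) := by
  have hd0 : 0 ≤ d := (norm_nonneg _).trans (hd 0)
  have hM0 : 0 ≤ M := (norm_nonneg _).trans (hM 0)
  have hB0 : 0 ≤ B := (abs_nonneg _).trans (hB 0)
  have hpc : Continuous p := continuous_iff_continuousAt.2 fun θ => (hp θ).continuousAt
  have hqc : Continuous q := continuous_iff_continuousAt.2 fun θ => (hq θ).continuousAt
  have hv := continuous_vertPrim hκ
  have hh := continuous_horPrim hκ
  have c1 : Continuous fun θ => vertPrim κ (q θ).1 (q θ).2 * (q' θ).1 := 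
    (hv.comp hqc).mul hq'.fst
  have c2 : Continuous fun θ => vertPrim κ (p θ).1 (p θ).2 * (p' θ).1 := 
    (hv.comp hpc).mul hp'.fst
  have c3 : Continuous fun θ => κ (p θ) *
        ((q θ - p θ).2 * (p' θ).1 - (q θ - p θ).1 * (p' θ).2) := by fun_prop
  have hE : ∀ θ, HasDerivAt (fun τ => doublePrim κ (q τ).1 (p τ).2 - doublePrim κ (p τ).1 (p τ).2)
      (vertPrim κ (q θ).1 (p θ).2 * (q' θ).1 + horPrim κ (q θ).1 (p θ).2 * (p' θ).2 -
      (vertPrim κ (p θ).1 (p θ).2 * (p' θ).1 + horPrim κ (p θ).1 (p θ).2 * (p' θ).2)) θ :=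
    fun θ => (hasDerivAt_doublePrim hκ (hq θ).fst (hp θ).snd).sub
      (hasDerivAt_doublePrim hκ (hp θ).fst (hp θ).snd)
  have c4 : Continuous fun θ => vertPrim κ (q θ).1 (p θ).2 * (q' θ).1 +
      horPrim κ (q θ).1 (p θ).2 * (p' θ).2 -
      (vertPrim κ (p θ).1 (p θ).2 * (p' θ).1 + horPrim κ (p θ).1 (p θ).2 * (p' θ).2) :=
    (((hv.comp (hqc.fst.prodMk hpc.snd)).mul hq'.fst).add
      ((hh.comp (hqc.fst.prodMk hpc.snd)).mul hp'.snd)).sub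
      (((hv.comp hpc).mul hp'.fst).add ((hh.comp hpc).mul hp'.snd))
  have hE0 := intervalIntegral.integral_eq_sub_of_hasDerivAt (fun θ _ => hE θ)
    (c4.intervalIntegrable 0 (2 * π))
  have hp2 : p (2 * π) = p 0 := by simpa using hpp 0
  have hq2 : q (2 * π) = q 0 := by simpa using hqp 0
  rw [hp2, hq2, sub_self] at hE0
  refine le_of_eq_of_le ?_ (abs_integral_sub_sub_sub_le c1 c2 c3 c4 fun θ => ?_)
  · rw [hE0, sub_zero]
  have n1 := abs_vertPrim_sub_le hκ hB (q θ).1 (p θ).2 (q θ).2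
  have n2 := abs_vertPrim_sub_sub_le hκ hL hL0 (p θ) (q θ)
  have n3 := abs_horPrim_sub_sub_le hκ hL hL0 (p θ) (q θ).1
  have m1 : |(q θ).1 - (p θ).1| ≤ d := (norm_fst_le (q θ - p θ)).trans (hd θ)
  have m2 : |(q θ).2 - (p θ).2| ≤ d := (norm_snd_le (q θ - p θ)).trans (hd θ)
  have m3 : |(p' θ).1| ≤ M := (norm_fst_le (p' θ)).trans (hM θ)
  have m4 : |(p' θ).2| ≤ M := (norm_snd_le (p' θ)).trans (hM θ)
  have m5 : |(q' θ).1 - (p' θ).1| ≤ d := (norm_fst_le (q' θ - p' θ)).trans (hd' θ)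
  set X := vertPrim κ (q θ).1 (q θ).2 - vertPrim κ (q θ).1 (p θ).2 with hX
  set Z := horPrim κ (q θ).1 (p θ).2 - horPrim κ (p θ).1 (p θ).2 with hZ
  calc _ = |X * ((q' θ).1 - (p' θ).1) + (X - κ (p θ) * ((q θ).2 - (p θ).2)) * (p' θ).1
        - (Z - κ (p θ) * ((q θ).1 - (p θ).1)) * (p' θ).2| := by
        congr 1
        simp only [hX, hZ, Prod.fst_sub, Prod.snd_sub]
        ring
    _ ≤ |X| * |(q' θ).1 - (p' θ).1| +
        |X - κ (p θ) * ((q θ).2 - (p θ).2)| * |(p' θ).1| +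
        |Z - κ (p θ) * ((q θ).1 - (p θ).1)| * |(p' θ).2| := by
        rw [← abs_mul, ← abs_mul, ← abs_mul]
        exact (abs_sub _ _).trans (add_le_add_left (abs_add_le _ _) _)
    _ ≤ (B * d) * d + (L * d * d) * M + (L * d * d) * M := by
        gcongr
        · exact n1.trans (by gcongr)
        · exact n2.trans (by gcongr; exact hd θ)
        · exact n3.trans (by gcongr)
    _ = _ := by ring

end Primitives

theorem abs_integral_slope_sub_le {m M d : ℝ} (hm : 0 < m) {p p' q q' : ℝ → ℝ × ℝ}
    (hp : ∀ θ, HasDerivAt p (p' θ) θ) (hq : ∀ θ, HasDerivAt q (q' θ) θ)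
    (hp' : Continuous p') (hq' : Continuous q') (hpp : Function.Periodic p (2 * π))
    (hqp : Function.Periodic q (2 * π)) (hpm : ∀ θ, m ≤ (p θ).2) (hqm : ∀ θ, m ≤ (q θ).2)
    (hM : ∀ θ, ‖p' θ‖ ≤ M) (hd : ∀ θ, ‖q θ - p θ‖ ≤ d) (hd' : ∀ θ, ‖q' θ - p' θ‖ ≤ d) :
    |(∫ θ in (0 : ℝ)..(2 * π), (q' θ).1 / (q θ).2) -
      (∫ θ in (0 : ℝ)..(2 * π), (p' θ).1 / (p θ).2) -
      ∫ θ in (0 : ℝ)..(2 * π), ((q θ - p θ).1 * ((p' θ).2 / (p θ).2 ^ 2) -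
        (q θ - p θ).2 * ((p' θ).1 / (p θ).2 ^ 2))| ≤
      2 * π * ((1 / m ^ 2 + M / m ^ 3) * d ^ 2) := by
  have hd0 : 0 ≤ d := (norm_nonneg _).trans (hd 0)
  have hM0 : 0 ≤ M := (norm_nonneg _).trans (hM 0)
  have hpc : Continuous p := continuous_iff_continuousAt.2 fun θ => (hp θ).continuousAt
  have hqc : Continuous q := continuous_iff_continuousAt.2 fun θ => (hq θ).continuousAt
  have hp0 : ∀ θ, (p θ).2 ≠ 0 := fun θ => (hm.trans_le (hpm θ)).ne'
  have hq0 : ∀ θ, (q θ).2 ≠ 0 := fun θ => (hm.trans_le (hqm θ)).ne'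
  have hp0' : ∀ θ, (p θ).2 ^ 2 ≠ 0 := fun θ => pow_ne_zero _ (hp0 θ)
  have c1 : Continuous fun θ => (q' θ).1 / (q θ).2 := hq'.fst.div hqc.snd hq0
  have c2 : Continuous fun θ => (p' θ).1 / (p θ).2 := hp'.fst.div hpc.snd hp0
  have c3 : Continuous fun θ => (q θ - p θ).1 * ((p' θ).2 / (p θ).2 ^ 2) -
      (q θ - p θ).2 * ((p' θ).1 / (p θ).2 ^ 2) :=
    ((hqc.sub hpc).fst.mul (hp'.snd.div (hpc.snd.pow 2) hp0')).sub
      ((hqc.sub hpc).snd.mul (hp'.fst.div (hpc.snd.pow 2) hp0'))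
  have c4 : Continuous fun θ => ((q' θ - p' θ).1 * (p θ).2 - (q θ - p θ).1 * (p' θ).2) /
      (p θ).2 ^ 2 :=
    (((hq'.sub hp').fst.mul hpc.snd).sub ((hqc.sub hpc).fst.mul hp'.snd)).div
      (hpc.snd.pow 2) hp0'
  have hE : ∀ θ, HasDerivAt (fun τ => (q τ - p τ).1 / (p τ).2)
      (((q' θ - p' θ).1 * (p θ).2 - (q θ - p θ).1 * (p' θ).2) / (p θ).2 ^ 2) θ :=
    fun θ => by
    have h1 : HasDerivAt (fun τ => (q τ - p τ).1) (q' θ - p' θ).1 θ := ((hq θ).sub (hp θ)).fst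
    have h2 : HasDerivAt (fun τ => (p τ).2) (p' θ).2 θ := (hp θ).snd
    exact h1.div h2 (hp0 θ)
  have hE0 := intervalIntegral.integral_eq_sub_of_hasDerivAt (fun θ _ => hE θ)
    (c4.intervalIntegrable 0 (2 * π))
  have hp2 : p (2 * π) = p 0 := by simpa using hpp 0
  have hq2 : q (2 * π) = q 0 := by simpa using hqp 0
  rw [hp2, hq2, sub_self] at hE0
  refine le_of_eq_of_le ?_ (abs_integral_sub_sub_sub_le c1 c2 c3 c4 fun θ => ?_)
  · rw [hE0, sub_zero]
  have m2 : |(q θ).2 - (p θ).2| ≤ d := (norm_snd_le (q θ - p θ)).trans (hd θ)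
  have m3 : |(p' θ).1| ≤ M := (norm_fst_le (p' θ)).trans (hM θ)
  have m5 : |(q' θ).1 - (p' θ).1| ≤ d := (norm_fst_le (q' θ - p' θ)).trans (hd' θ)
  have h1 := hp0 θ
  have h2 := hq0 θ
  have h3 := hpm θ
  have h4 := hqm θ
  have e1 : |(p θ).2| = (p θ).2 := abs_of_pos (hm.trans_le h3)
  have e2 : |(q θ).2| = (q θ).2 := abs_of_pos (hm.trans_le h4)
  calc _ = |((q θ).2 - (p θ).2) / ((p θ).2 * (q θ).2) * (((q' θ).1 - (p' θ).1) -
        (p' θ).1 * ((q θ).2 - (p θ).2) / (p θ).2)| := by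
        rw [← abs_neg]
        congr 1
        simp only [Prod.fst_sub, Prod.snd_sub]
        field_simp
        ring
    _ ≤ |(q θ).2 - (p θ).2| / (|(p θ).2| * |(q θ).2|) * (|(q' θ).1 - (p' θ).1| +
        |(p' θ).1| * |(q θ).2 - (p θ).2| / |(p θ).2|) := by
        rw [abs_mul, abs_div, abs_mul]
        refine mul_le_mul_of_nonneg_left ((abs_sub _ _).trans_eq ?_) (by positivity)
        rw [abs_div, abs_mul]
    _ ≤ d / (m * m) * (d + M * d / m) := by
        have h5 := hm.trans_le h3
        rw [e1, e2]
        gcongr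
    _ = _ := by field_simp

/-- The curve `(a + δ y sin θ, y (1 - δ cos θ))` described by slowly varying `(a, y)`. -/
def liftCurve (δ : ℝ) (w : ℝ → ℝ × ℝ) (θ : ℝ) : ℝ × ℝ :=
  ((w θ).1 + δ * (w θ).2 * sin θ, (w θ).2 * (1 - δ * cos θ))

/-- The derivative of `liftCurve δ w` when `w'` is the derivative of `w`. -/
def liftDeriv (δ : ℝ) (w w' : ℝ → ℝ × ℝ) (θ : ℝ) : ℝ × ℝ :=
  ((w' θ).1 + δ * (w' θ).2 * sin θ + δ * (w θ).2 * cos θ,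
    (w' θ).2 * (1 - δ * cos θ) + δ * (w θ).2 * sin θ)

theorem hasDerivAt_liftCurve (δ : ℝ) {w w' : ℝ → ℝ × ℝ} {θ : ℝ} (hw : HasDerivAt w (w' θ) θ) :
    HasDerivAt (liftCurve δ w) (liftDeriv δ w w' θ) θ := by
  have h1 : HasDerivAt (fun τ => (w τ).1) (w' θ).1 θ := hw.fst
  have h2 : HasDerivAt (fun τ => (w τ).2) (w' θ).2 θ := hw.snd
  refine HasDerivAt.prodMk ?_ ?_
  · refine (h1.add ((h2.const_mul δ).mul (hasDerivAt_sin θ))).congr_deriv ?_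
    ring
  · refine (h2.mul (((hasDerivAt_cos θ).const_mul δ).const_sub 1)).congr_deriv ?_
    ring

theorem periodic_liftCurve (δ : ℝ) {w : ℝ → ℝ × ℝ} (hw : Function.Periodic w (2 * π)) :
    Function.Periodic (liftCurve δ w) (2 * π) := fun θ => by
  simp only [liftCurve, hw θ, sin_add_two_pi, cos_add_two_pi]

/-- The action functional: a length term plus `η` times the integral of the one-form `q dx`. -/
def loopAction (κ : ℝ × ℝ → ℝ) (δ η : ℝ) (w w' : ℝ → ℝ × ℝ) : ℝ :=
  η * (∫ θ in (0 : ℝ)..(2 * π), vertPrim κ (liftCurve δ w θ).1 (liftCurve δ w θ).2 *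
    (liftDeriv δ w w' θ).1) - ∫ θ in (0 : ℝ)..(2 * π), (w' θ).1 / (w θ).2

/-- First-order expansion of the action at a curve solving the balanced equation with
constant multiplier `c`. -/
theorem abs_loopAction_sub_le {κ : ℝ × ℝ → ℝ} (hκ : Continuous κ) {B L M N d m δ η : ℝ}
    (hB : ∀ p, |κ p| ≤ B) (hL : ∀ p p', |κ p - κ p'| ≤ L * ‖p - p'‖) (hL0 : 0 ≤ L)
    (hm : 0 < m) (hδ0 : 0 ≤ δ) (hδ : δ ≤ 1) {p p' q q' : ℝ → ℝ × ℝ}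
    (hp : ∀ θ, HasDerivAt p (p' θ) θ) (hq : ∀ θ, HasDerivAt q (q' θ) θ)
    (hp' : Continuous p') (hq' : Continuous q') (hpp : Function.Periodic p (2 * π))
    (hqp : Function.Periodic q (2 * π)) (hpm : ∀ θ, m ≤ (p θ).2) (hqm : ∀ θ, m ≤ (q θ).2)
    (hpN : ∀ θ, (p θ).2 ≤ N)
    (hM : ∀ θ, ‖p' θ‖ ≤ M) (hd : ∀ θ, ‖q θ - p θ‖ ≤ d) (hd' : ∀ θ, ‖q' θ - p' θ‖ ≤ d)
    {c h : ℝ × ℝ}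
    (hc1 : ∀ θ, (p' θ).1 / (p θ).2 ^ 2 + η * κ (liftCurve δ p θ) *
      ((1 - δ * cos θ) * (p' θ).1 + δ * (p θ).2 * (cos θ - δ)) = -c.1)
    (hc2 : ∀ θ, (p' θ).2 / (p θ).2 ^ 2 + η * κ (liftCurve δ p θ) * (liftDeriv δ p p' θ).2 = -c.2)
    (hh : ∫ θ in (0 : ℝ)..(2 * π), (q θ - p θ) = (2 * π) • h) :
    |loopAction κ δ η q q' - loopAction κ δ η p p' - 2 * π * (c.2 * h.1 - c.1 * h.2)| ≤
      2 * π * ((|η| * (9 * (B + 2 * L * (2 * M + N))) + (1 / m ^ 2 + M / m ^ 3)) * d ^ 2) := by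
  have hd0 : 0 ≤ d := (norm_nonneg _).trans (hd 0)
  have hM0 : 0 ≤ M := (norm_nonneg _).trans (hM 0)
  have hpc : Continuous p := continuous_iff_continuousAt.2 fun θ => (hp θ).continuousAt
  have hqc : Continuous q := continuous_iff_continuousAt.2 fun θ => (hq θ).continuousAt
  have m1 : ∀ θ, |(q θ).1 - (p θ).1| ≤ d := fun θ => (norm_fst_le (q θ - p θ)).trans (hd θ)
  have m2 : ∀ θ, |(q θ).2 - (p θ).2| ≤ d := fun θ => (norm_snd_le (q θ - p θ)).trans (hd θ)
  have m3 : ∀ θ, |(p' θ).1| ≤ M := fun θ => (norm_fst_le (p' θ)).trans (hM θ)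
  have m4 : ∀ θ, |(p' θ).2| ≤ M := fun θ => (norm_snd_le (p' θ)).trans (hM θ)
  have m5 : ∀ θ, |(q' θ).1 - (p' θ).1| ≤ d := fun θ => (norm_fst_le (q' θ - p' θ)).trans (hd' θ)
  have m6 : ∀ θ, |(q' θ).2 - (p' θ).2| ≤ d := fun θ => (norm_snd_le (q' θ - p' θ)).trans (hd' θ)
  have aux : ∀ {t b e : ℝ}, |t| ≤ b → |e| ≤ 1 → |δ * t * e| ≤ b := by
    intro t b e ht he
    rw [abs_mul, abs_mul, abs_of_nonneg hδ0]
    have h1 : δ * |t| ≤ |t| := mul_le_of_le_one_left (abs_nonneg t) hδ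
    have h2 : δ * |t| * |e| ≤ δ * |t| := mul_le_of_le_one_right (by positivity) he
    linarith
  have hs : ∀ θ, |sin θ| ≤ 1 := abs_sin_le_one
  have hco : ∀ θ, |cos θ| ≤ 1 := abs_cos_le_one
  have hpy : ∀ θ, |(p θ).2| ≤ N := fun θ => by
    rw [abs_of_pos (hm.trans_le (hpm θ))]; exact hpN θ
  have hcont : ∀ w w' : ℝ → ℝ × ℝ, Continuous w → Continuous w' →
      Continuous (liftDeriv δ w w') := fun w w' hw hw' => by
    unfold liftDeriv; fun_prop
  have hform := abs_integral_vertPrim_sub_le hκ (M := 2 * M + N) (d := 3 * d) hB hL hL0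
    (fun θ => hasDerivAt_liftCurve δ (hp θ)) (fun θ => hasDerivAt_liftCurve δ (hq θ))
    (hcont p p' hpc hp') (hcont q q' hqc hq') (periodic_liftCurve δ hpp) (periodic_liftCurve δ hqp)
    (fun θ => by
      have h1 := abs_le.1 (aux (m4 θ) (hs θ))
      have h2 := abs_le.1 (aux (hpy θ) (hco θ))
      have h3 := abs_le.1 (aux (m4 θ) (hco θ))
      have h4 := abs_le.1 (aux (hpy θ) (hs θ))
      have h5 := abs_le.1 (m3 θ)
      have h6 := abs_le.1 (m4 θ)
      rw [Prod.norm_def]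
      simp only [liftDeriv, Real.norm_eq_abs]
      refine max_le (abs_le.2 ⟨?_, ?_⟩) (abs_le.2 ⟨?_, ?_⟩) <;> linarith)
    (fun θ => by
      have h1 := abs_le.1 (aux (m2 θ) (hs θ))
      have h3 := abs_le.1 (aux (m2 θ) (hco θ))
      have h5 := abs_le.1 (m1 θ)
      have h6 := abs_le.1 (m2 θ)
      rw [Prod.norm_def]
      simp only [liftCurve, Real.norm_eq_abs, Prod.fst_sub, Prod.snd_sub]
      refine max_le (abs_le.2 ⟨?_, ?_⟩) (abs_le.2 ⟨?_, ?_⟩) <;> linarith)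
    (fun θ => by
      have h1 := abs_le.1 (aux (m6 θ) (hs θ))
      have h2 := abs_le.1 (aux (m2 θ) (hco θ))
      have h3 := abs_le.1 (aux (m6 θ) (hco θ))
      have h4 := abs_le.1 (aux (m2 θ) (hs θ))
      have h5 := abs_le.1 (m5 θ)
      have h6 := abs_le.1 (m6 θ)
      rw [Prod.norm_def]
      simp only [liftDeriv, Real.norm_eq_abs, Prod.fst_sub, Prod.snd_sub]
      refine max_le (abs_le.2 ⟨?_, ?_⟩) (abs_le.2 ⟨?_, ?_⟩) <;> linarith)
  have hslope := abs_integral_slope_sub_le hm hp hq hp' hq' hpp hqp hpm hqm hM hd hd'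
  set I₁ := ∫ θ in (0 : ℝ)..(2 * π), κ (liftCurve δ p θ) *
    ((liftCurve δ q θ - liftCurve δ p θ).2 * (liftDeriv δ p p' θ).1 -
      (liftCurve δ q θ - liftCurve δ p θ).1 * (liftDeriv δ p p' θ).2) with hI₁
  set I₂ := ∫ θ in (0 : ℝ)..(2 * π), ((q θ - p θ).1 * ((p' θ).2 / (p θ).2 ^ 2) -
        (q θ - p θ).2 * ((p' θ).1 / (p θ).2 ^ 2)) with hI₂
  have key : η * I₁ - I₂ = 2 * π * (c.2 * h.1 - c.1 * h.2) := by
    have c1 : Continuous fun θ => η * (κ (liftCurve δ p θ) *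
      ((liftCurve δ q θ - liftCurve δ p θ).2 * (liftDeriv δ p p' θ).1 -
      (liftCurve δ q θ - liftCurve δ p θ).1 * (liftDeriv δ p p' θ).2)) := by
      have := hcont p p' hpc hp'
      unfold liftCurve; fun_prop
    have hp0' : ∀ θ, (p θ).2 ^ 2 ≠ 0 := fun θ => pow_ne_zero _ (hm.trans_le (hpm θ)).ne'
    have c2 : Continuous fun θ => (q θ - p θ).1 * ((p' θ).2 / (p θ).2 ^ 2) -
        (q θ - p θ).2 * ((p' θ).1 / (p θ).2 ^ 2) :=
      ((hqc.sub hpc).fst.mul (hp'.snd.div (hpc.snd.pow 2) hp0')).sub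
        ((hqc.sub hpc).snd.mul (hp'.fst.div (hpc.snd.pow 2) hp0'))
    have hv : Continuous fun θ => q θ - p θ := hqc.sub hpc
    let Λ : ℝ × ℝ →L[ℝ] ℝ := c.2 • ContinuousLinearMap.fst ℝ ℝ ℝ -
      c.1 • ContinuousLinearMap.snd ℝ ℝ ℝ
    have hΛ := Λ.intervalIntegral_comp_comm (hv.intervalIntegrable (μ := volume) 0 (2 * π))
    rw [hh, map_smul] at hΛ
    have e2 : (2 * π) • Λ h = 2 * π * (c.2 * h.1 - c.1 * h.2) := by simp [Λ]
    rw [← e2, ← hΛ, hI₁, hI₂, ← intervalIntegral.integral_const_mul,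
      ← intervalIntegral.integral_sub (c1.intervalIntegrable _ _) (c2.intervalIntegrable _ _)]
    refine intervalIntegral.integral_congr fun θ _ => ?_
    have h1 := hc1 θ
    have h2 := hc2 θ
    simp only [Λ, sub_apply, smul_apply,
      ContinuousLinearMap.coe_fst', ContinuousLinearMap.coe_snd', smul_eq_mul]
    rw [← neg_eq_iff_eq_neg] at h1 h2
    rw [← h1, ← h2]
    simp only [liftCurve, liftDeriv, Prod.fst_sub, Prod.snd_sub]
    have := sin_sq_add_cos_sq θ
    generalize κ _ = k
    linear_combination (-(η * k * ((q θ).2 - (p θ).2) * δ ^ 2 * (p θ).2)) * this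
  have e : loopAction κ δ η q q' - loopAction κ δ η p p' - 2 * π * (c.2 * h.1 - c.1 * h.2) =
      η * ((∫ θ in (0 : ℝ)..(2 * π), vertPrim κ (liftCurve δ q θ).1 (liftCurve δ q θ).2 *
        (liftDeriv δ q q' θ).1) - (∫ θ in (0 : ℝ)..(2 * π), vertPrim κ (liftCurve δ p θ).1
        (liftCurve δ p θ).2 * (liftDeriv δ p p' θ).1) - I₁) -
      ((∫ θ in (0 : ℝ)..(2 * π), (q' θ).1 / (q θ).2) -
      (∫ θ in (0 : ℝ)..(2 * π), (p' θ).1 / (p θ).2) - I₂) := by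
    rw [← key]; simp only [loopAction]; ring
  rw [e]
  refine (abs_sub _ _).trans ?_
  rw [abs_mul]
  refine (add_le_add (mul_le_mul_of_nonneg_left hform (abs_nonneg η)) hslope).trans_eq ?_
  ring

/-- A periodic family of bounded Lipschitz functions of the plane. -/
structure IsTame (f : ℝ → ℝ × ℝ → ℝ) (B L : ℝ) : Prop where
  cont : Continuous (Function.uncurry f)
  per : ∀ θ w, f (θ + 2 * π) w = f θ w
  bound : ∀ θ w, |f θ w| ≤ B
  lip : ∀ θ w w', |f θ w - f θ w'| ≤ L * ‖w - w'‖

section IsTame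

variable {f f' : ℝ → ℝ × ℝ → ℝ} {B B' L L' : ℝ}

theorem IsTame.bound_nonneg (h : IsTame f B L) : 0 ≤ B := (abs_nonneg _).trans (h.bound 0 0)

theorem IsTame.lip_nonneg (h : IsTame f B L) : 0 ≤ L := by
  have h1 := (abs_nonneg _).trans (h.lip 0 (1, 0) 0)
  simpa using h1

theorem IsTame.of_angle {φ : ℝ → ℝ} (hφ : Continuous φ) (hp : Function.Periodic φ (2 * π))
    (hB : ∀ θ, |φ θ| ≤ B) : IsTame (fun θ _ => φ θ) B 0 where
  cont := hφ.comp continuous_fst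
  per θ _ := hp θ
  bound θ _ := hB θ
  lip := by simp

theorem IsTame.mul (h : IsTame f B L) (h' : IsTame f' B' L') :
    IsTame (fun θ w => f θ w * f' θ w) (B * B') (B * L' + B' * L) where
  cont := h.cont.mul h'.cont
  per θ w := by rw [h.per, h'.per]
  bound θ w := by
    rw [abs_mul]
    exact mul_le_mul (h.bound _ _) (h'.bound _ _) (abs_nonneg _) h.bound_nonneg
  lip θ w w' := by
    have hB := h.bound_nonneg
    have hL := h.lip_nonneg
    calc |f θ w * f' θ w - f θ w' * f' θ w'|
        = |f θ w * (f' θ w - f' θ w') + f' θ w' * (f θ w - f θ w')| := by congr 1; ring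
      _ ≤ |f θ w| * |f' θ w - f' θ w'| + |f' θ w'| * |f θ w - f θ w'| := by
        rw [← abs_mul, ← abs_mul]; exact abs_add_le _ _
      _ ≤ B * (L' * ‖w - w'‖) + B' * (L * ‖w - w'‖) := by
        have hB' := h'.bound_nonneg
        gcongr
        exacts [h.bound _ _, h'.lip _ _ _, h'.bound _ _, h.lip _ _ _]
      _ = _ := by ring

theorem IsTame.one_half_le_one_add_mul (h : IsTame f B L) {η : ℝ} (hη : |η| * B ≤ 1 / 2) (θ : ℝ)
    (w : ℝ × ℝ) : 1 / 2 ≤ 1 + η * f θ w ∧ 1 + η * f θ w ≤ 2 := by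
  have h1 : |η * f θ w| ≤ 1 / 2 := by
    rw [abs_mul]; exact (mul_le_mul_of_nonneg_left (h.bound _ _) (abs_nonneg _)).trans hη
  have := abs_le.1 h1
  constructor <;> linarith

theorem IsTame.inv_one_add_mul (h : IsTame f B L) {η : ℝ} (hη : |η| * B ≤ 1 / 2) (hη1 : |η| ≤ 1) :
    IsTame (fun θ w => (1 + η * f θ w)⁻¹) 2 (4 * L) where
  cont := (continuous_const.add (continuous_const.mul h.cont)).inv₀ fun x => by
    have := (h.one_half_le_one_add_mul hη x.1 x.2).1
    exact (lt_of_lt_of_le (by norm_num) this).ne'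
  per θ w := by rw [h.per]
  bound θ w := by
    have := (h.one_half_le_one_add_mul hη θ w).1
    rw [abs_inv, abs_of_pos (by linarith), inv_le_comm₀ (by linarith) (by norm_num)]
    linarith
  lip θ w w' := by
    have h1 := (h.one_half_le_one_add_mul hη θ w).1
    have h2 := (h.one_half_le_one_add_mul hη θ w').1
    set X := 1 + η * f θ w with hX
    set Y := 1 + η * f θ w' with hY
    have e : X⁻¹ - Y⁻¹ = -(η * (f θ w - f θ w')) * (X⁻¹ * Y⁻¹) := by
      have hX0 : X ≠ 0 := by linarith
      have hY0 : Y ≠ 0 := by linarith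
      field_simp
      rw [hX, hY]; ring
    have i1 : X⁻¹ ≤ 2 := by rw [inv_le_comm₀ (by linarith) (by norm_num)]; linarith
    have i2 : Y⁻¹ ≤ 2 := by rw [inv_le_comm₀ (by linarith) (by norm_num)]; linarith
    have i3 : 0 ≤ X⁻¹ := inv_nonneg.2 (by linarith)
    have i4 : 0 ≤ Y⁻¹ := inv_nonneg.2 (by linarith)
    rw [e, abs_mul, abs_neg, abs_mul, abs_of_nonneg (mul_nonneg i3 i4)]
    have hL := h.lip_nonneg
    calc |η| * |f θ w - f θ w'| * (X⁻¹ * Y⁻¹) ≤ 1 * (L * ‖w - w'‖) * (2 * 2) := by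
          gcongr
          exact h.lip _ _ _
      _ = _ := by ring

theorem IsTame.abs_inv_one_add_mul_sub_one_le (h : IsTame f B L) {η : ℝ} (hη : |η| * B ≤ 1 / 2)
    (θ : ℝ) (w : ℝ × ℝ) : |(1 + η * f θ w)⁻¹ - 1| ≤ 2 * B * |η| := by
  have h1 := (h.one_half_le_one_add_mul hη θ w).1
  set X := 1 + η * f θ w with hX
  have e : X⁻¹ - 1 = -(η * f θ w) * X⁻¹ := by
    have hX0 : X ≠ 0 := by linarith
    field_simp
    rw [hX]; ring
  have i1 : X⁻¹ ≤ 2 := by rw [inv_le_comm₀ (by linarith) (by norm_num)]; linarith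
  have i3 : 0 ≤ X⁻¹ := inv_nonneg.2 (by linarith)
  rw [e, abs_mul, abs_neg, abs_mul, abs_of_nonneg i3]
  calc |η| * |f θ w| * X⁻¹ ≤ |η| * B * 2 := by
        have := h.bound_nonneg
        gcongr
        exact h.bound _ _
    _ = _ := by ring

end IsTame

/-- Truncation of a real number to the interval `[m, M]`. -/
def clamp (m M t : ℝ) : ℝ := max m (min M t)

theorem clamp_of_mem {m M t : ℝ} (h : t ∈ Set.Icc m M) : clamp m M t = t := by
  rw [clamp, min_eq_right h.2, max_eq_right h.1]

theorem clamp_mem {m M : ℝ} (h : m ≤ M) (t : ℝ) : clamp m M t ∈ Set.Icc m M :=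
  ⟨le_max_left _ _, max_le h (min_le_left _ _)⟩

theorem abs_clamp_sub_clamp_le (m M t t' : ℝ) : |clamp m M t - clamp m M t'| ≤ |t - t'| := by
  have := ((LipschitzWith.id.const_min M).const_max m).dist_le_mul t t'
  simpa [Real.dist_eq, clamp] using this

theorem continuous_clamp (m M : ℝ) : Continuous (clamp m M) :=
  continuous_const.max (continuous_const.min continuous_id)

/-- The point of the curve with slow variables `w` (truncated in height) at angle `θ`. -/
def liftPoint (m M δ θ : ℝ) (w : ℝ × ℝ) : ℝ × ℝ :=
  (w.1 + δ * clamp m M w.2 * sin θ, clamp m M w.2 * (1 - δ * cos θ))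

/-- The weight `y² / (1 + η κ y² ρ)`. -/
def loopWeight (κ : ℝ × ℝ → ℝ) (m M δ η θ : ℝ) (w : ℝ × ℝ) : ℝ :=
  clamp m M w.2 * clamp m M w.2 * (1 + η * (κ (liftPoint m M δ θ w) *
    (clamp m M w.2 * clamp m M w.2 * (1 - δ * cos θ))))⁻¹

/-- The drift `-κ δ y s (cos θ - δ, sin θ)` of the slow variables. -/
def loopDrift (κ : ℝ × ℝ → ℝ) (m M δ η θ : ℝ) (w : ℝ × ℝ) : ℝ × ℝ :=
  loopWeight κ m M δ η θ w • (κ (liftPoint m M δ θ w) * clamp m M w.2 * (-δ * (cos θ - δ)),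
    κ (liftPoint m M δ θ w) * clamp m M w.2 * (-δ * sin θ))

theorem isTame_clamp {m M : ℝ} (hm : 0 < m) (hmM : m ≤ M) :
    IsTame (fun _ w => clamp m M w.2) M 1 where
  cont := (continuous_clamp m M).comp (continuous_snd.comp continuous_snd)
  per _ _ := rfl
  bound _ w := by
    have := clamp_mem hmM w.2
    rw [abs_of_pos (hm.trans_le this.1)]
    exact this.2
  lip _ w w' := by
    rw [one_mul]
    exact (abs_clamp_sub_clamp_le _ _ _ _).trans (norm_snd_le (w - w'))

theorem isTame_comp_liftPoint {κ : ℝ × ℝ → ℝ} (hκ : Continuous κ) {B L m M δ : ℝ}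
    (hB : ∀ p, |κ p| ≤ B) (hL : ∀ p p', |κ p - κ p'| ≤ L * ‖p - p'‖) (hL0 : 0 ≤ L)
    (hδ0 : 0 ≤ δ) (hδ : δ ≤ 1) :
    IsTame (fun θ w => κ (liftPoint m M δ θ w)) B (L * 2) where
  cont := by
    have := continuous_clamp m M
    unfold liftPoint
    fun_prop
  per θ w := by simp [liftPoint]
  bound _ _ := hB _
  lip θ w w' := by
    refine (hL _ _).trans ?_
    rw [mul_assoc]
    refine mul_le_mul_of_nonneg_left ?_ hL0
    have h1 : |w.1 - w'.1| ≤ ‖w - w'‖ := norm_fst_le (w - w')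
    have h2 : |clamp m M w.2 - clamp m M w'.2| ≤ ‖w - w'‖ :=
      (abs_clamp_sub_clamp_le _ _ _ _).trans (norm_snd_le (w - w'))
    have aux : ∀ e, |e| ≤ 1 → |δ * (clamp m M w.2 - clamp m M w'.2) * e| ≤ ‖w - w'‖ := by
      intro e he
      rw [abs_mul, abs_mul, abs_of_nonneg hδ0]
      calc δ * |clamp m M w.2 - clamp m M w'.2| * |e| ≤ 1 * ‖w - w'‖ * 1 := by gcongr
        _ = _ := by ring
    have h3 := abs_le.1 (aux _ (abs_sin_le_one θ))
    have h4 := abs_le.1 (aux _ (abs_cos_le_one θ))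
    have h5 := abs_le.1 h1
    have h6 := abs_le.1 h2
    rw [Prod.norm_def]
    simp only [liftPoint, Real.norm_eq_abs, Prod.fst_sub, Prod.snd_sub]
    refine max_le (abs_le.2 ⟨?_, ?_⟩) (abs_le.2 ⟨?_, ?_⟩) <;> linarith

/-- For small `η` the loop data are uniformly tame and depend on `η` in a Lipschitz way. -/
theorem exists_tameData_loop {κ : ℝ × ℝ → ℝ} (hκ : Continuous κ) {B₀ L₀ m M δ : ℝ}
    (hB₀ : ∀ p, |κ p| ≤ B₀) (hL₀ : ∀ p p', |κ p - κ p'| ≤ L₀ * ‖p - p'‖) (hL₀' : 0 ≤ L₀)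
    (hm : 0 < m) (hmM : m ≤ M) (hδ0 : 0 ≤ δ) (hδ : δ ≤ 1) :
    ∃ B > (0 : ℝ), ∃ L > (0 : ℝ), ∃ s₀ > (0 : ℝ), ∃ η₀ > (0 : ℝ), ∀ η : ℝ, |η| ≤ η₀ →
      TameData B L s₀ (loopDrift κ m M δ η) (loopWeight κ m M δ η) ∧
      (∀ θ w, loopWeight κ m M δ η θ w * (1 + η * (κ (liftPoint m M δ θ w) *
        (clamp m M w.2 * clamp m M w.2 * (1 - δ * cos θ)))) = clamp m M w.2 * clamp m M w.2) ∧
      (∀ θ w, ‖loopDrift κ m M δ η θ w - loopDrift κ m M δ 0 θ w‖ ≤ B * |η|) ∧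
      ∀ θ w, |loopWeight κ m M δ η θ w - loopWeight κ m M δ 0 θ w| ≤ B * |η| := by
  have ty := isTame_clamp hm hmM
  have tκ := isTame_comp_liftPoint (m := m) (M := M) hκ hB₀ hL₀ hL₀' hδ0 hδ
  have tρ : IsTame (fun θ _ => 1 - δ * cos θ) 2 0 :=
    IsTame.of_angle (by fun_prop) (fun θ => by simp) fun θ => by
      have := abs_le.1 (abs_cos_le_one θ)
      exact abs_le.2 ⟨by nlinarith, by nlinarith⟩
  have tc : IsTame (fun θ _ => -δ * (cos θ - δ)) 2 0 :=
    IsTame.of_angle (by fun_prop) (fun θ => by simp) fun θ => by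
      have := abs_le.1 (abs_cos_le_one θ)
      exact abs_le.2 ⟨by nlinarith, by nlinarith⟩
  have ts : IsTame (fun θ _ => -δ * sin θ) 2 0 :=
    IsTame.of_angle (by fun_prop) (fun θ => by simp) fun θ => by
      have := abs_le.1 (abs_sin_le_one θ)
      exact abs_le.2 ⟨by nlinarith, by nlinarith⟩
  have tf := tκ.mul ((ty.mul ty).mul tρ)
  have t1 := (tκ.mul ty).mul tc
  have t2 := (tκ.mul ty).mul ts
  obtain ⟨Bf, hBf⟩ : ∃ Bf, Bf = B₀ * (M * M * 2) := ⟨_, rfl⟩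
  rw [← hBf] at tf
  obtain ⟨B₁, hB₁⟩ : ∃ B₁, B₁ = B₀ * M * 2 := ⟨_, rfl⟩
  rw [← hB₁] at t1 t2
  have hBf0 := tf.bound_nonneg
  have hB₁0 := t1.bound_nonneg
  have hM : 0 < M := hm.trans_le hmM
  have tw : ∀ η : ℝ, |η| ≤ 1 / (2 * Bf + 1) → |η| * Bf ≤ 1 / 2 ∧ |η| ≤ 1 := by
    intro η hη
    have h1 : 1 / (2 * Bf + 1) ≤ 1 := by rw [div_le_one (by positivity)]; linarith
    refine ⟨?_, hη.trans h1⟩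
    rw [le_div_iff₀ (by positivity)] at hη
    nlinarith [abs_nonneg η]
  have hexp : ∃ Bw Lw : ℝ, ∀ η : ℝ, |η| ≤ 1 / (2 * Bf + 1) →
      IsTame (loopWeight κ m M δ η) Bw Lw :=
    ⟨_, _, fun η hη => (ty.mul ty).mul (tf.inv_one_add_mul (tw η hη).1 (tw η hη).2)⟩
  obtain ⟨Bw, Lw, tW⟩ := hexp
  have tW0 := tW 0 (by rw [abs_zero]; positivity)
  have hBw0 := tW0.bound_nonneg
  have hLw0 := tW0.lip_nonneg
  obtain ⟨L₁, hg⟩ : ∃ L₁ : ℝ, ∀ η : ℝ, |η| ≤ 1 / (2 * Bf + 1) →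
      IsTame (fun θ w => (loopDrift κ m M δ η θ w).1) (Bw * B₁) L₁ ∧
      IsTame (fun θ w => (loopDrift κ m M δ η θ w).2) (Bw * B₁) L₁ :=
    ⟨_, fun η hη => ⟨(tW η hη).mul t1, (tW η hη).mul t2⟩⟩
  have hL₁0 := (hg 0 (by rw [abs_zero]; positivity)).1.lip_nonneg
  have hdiff : ∀ η : ℝ, |η| ≤ 1 / (2 * Bf + 1) → ∀ θ w,
      |loopWeight κ m M δ η θ w - loopWeight κ m M δ 0 θ w| ≤ M * M * (2 * Bf) * |η| := by
    intro η hη θ w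
    have h1 := tf.abs_inv_one_add_mul_sub_one_le (tw η hη).1 θ w
    have h2 := (ty.mul ty).bound θ w
    simp only [loopWeight, zero_mul, add_zero, inv_one]
    rw [← mul_sub, abs_mul, mul_assoc (M * M)]
    exact mul_le_mul h2 h1 (abs_nonneg _) (by positivity)
  refine ⟨Bw * B₁ + Bw + M * M * (2 * Bf) * B₁ + M * M * (2 * Bf) + 1, by positivity,
    L₁ + Lw + 1, by positivity, m * m / 2, by positivity, 1 / (2 * Bf + 1), by positivity,
    fun η hη => ⟨?_, ?_, ?_, ?_⟩⟩
  · obtain ⟨h1, h2⟩ := hg η hη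
    refine ⟨?_, (tW η hη).cont, ?_, (tW η hη).per, ?_, ?_, ?_, ?_, ?_⟩
    · exact h1.cont.prodMk h2.cont
    · exact fun θ w => Prod.ext (h1.per θ w) (h2.per θ w)
    · intro θ w
      have : 0 ≤ M * M * (2 * Bf) * B₁ := by positivity
      have : 0 ≤ M * M * (2 * Bf) := by positivity
      have i1 := h1.bound θ w
      have i2 := h2.bound θ w
      rw [Prod.norm_def]
      exact max_le (by rw [Real.norm_eq_abs]; linarith) (by rw [Real.norm_eq_abs]; linarith)
    · intro θ w
      have : 0 ≤ M * M * (2 * Bf) * B₁ := by positivity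
      have : 0 ≤ M * M * (2 * Bf) := by positivity
      have : 0 ≤ Bw * B₁ := by positivity
      have i1 := (tW η hη).bound θ w
      linarith
    · intro θ w
      have h3 := tf.one_half_le_one_add_mul (tw η hη).1 θ w
      have h4 := (clamp_mem hmM w.2).1
      rw [loopWeight, ← div_eq_mul_inv, div_le_div_iff₀ (by norm_num) (by linarith [h3.1])]
      have h5 : m * m ≤ clamp m M w.2 * clamp m M w.2 := mul_le_mul h4 h4 hm.le (hm.le.trans h4)
      have h6 := mul_le_mul_of_nonneg_left h3.2 (by positivity : 0 ≤ m * m)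
      linarith
    · intro θ w w'
      have i1 := h1.lip θ w w'
      have i2 := h2.lip θ w w'
      have i3 : 0 ≤ (Lw + 1) * ‖w - w'‖ := by positivity
      rw [Prod.norm_def]
      simp only [Prod.fst_sub, Prod.snd_sub, Real.norm_eq_abs]
      exact max_le (by linarith) (by linarith)
    · intro θ w w'
      have i1 := (tW η hη).lip θ w w'
      have i3 : 0 ≤ (L₁ + 1) * ‖w - w'‖ := by positivity
      linarith
  · intro θ w
    have h3 := tf.one_half_le_one_add_mul (tw η hη).1 θ w
    rw [loopWeight, mul_assoc, inv_mul_cancel₀ (by linarith [h3.1]), mul_one]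
  · intro θ w
    have h1 := hdiff η hη θ w
    have h2 := t1.bound θ w
    have h3 := t2.bound θ w
    have h4 : 0 ≤ M * M * (2 * Bf) * |η| := by positivity
    have h5 : 0 ≤ (Bw * B₁ + Bw + M * M * (2 * Bf) + 1) * |η| := by positivity
    rw [loopDrift, loopDrift, ← sub_smul, norm_smul, Real.norm_eq_abs]
    refine (mul_le_mul h1 (?_ : _ ≤ B₁) (norm_nonneg _) h4).trans (by linarith)
    rw [Prod.norm_def]
    exact max_le h2 h3
  · intro θ w
    have h1 := hdiff η hη θ w
    have h5 : 0 ≤ (Bw * B₁ + Bw + M * M * (2 * Bf) * B₁ + 1) * |η| := by positivity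
    linarith

theorem liftCurve_eq_liftPoint {m M δ θ : ℝ} {w : ℝ → ℝ × ℝ} (h : (w θ).2 ∈ Set.Icc m M) :
    liftCurve δ w θ = liftPoint m M δ θ (w θ) := by
  rw [liftCurve, liftPoint, clamp_of_mem h]

/-- Lyapunov–Schmidt reduction: for small `η ≠ 0` there is a family `W z` of periodic solutions of
the balanced equation, whose multiplier `ν` is a rotated gradient. -/
theorem exists_reduced_function {κ : ℝ × ℝ → ℝ} (hκ : Continuous κ) {B₀ L₀ m M δ : ℝ}
    (hB₀ : ∀ p, |κ p| ≤ B₀) (hL₀ : ∀ p p', |κ p - κ p'| ≤ L₀ * ‖p - p'‖) (hL₀' : 0 ≤ L₀)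
    (hm : 0 < m) (hmM : m ≤ M) (hδ0 : 0 ≤ δ) (hδ : δ ≤ 1) :
    ∃ C > (0 : ℝ), ∃ η₀ > (0 : ℝ), ∀ η : ℝ, η ≠ 0 → |η| ≤ η₀ →
      ∃ (W : ℝ × ℝ → ℝ → ℝ × ℝ) (ν : ℝ × ℝ → ℝ × ℝ) (Φ : ℝ × ℝ → ℝ),
        (∀ z, Function.Periodic (W z) (2 * π)) ∧
        (∀ z θ, HasDerivAt (W z) (η • (loopDrift κ m M δ η θ (W z θ) -
          loopWeight κ m M δ η θ (W z θ) • ν z)) θ) ∧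
        (∀ z θ, ‖W z θ - z‖ ≤ C * |η|) ∧ Continuous ν ∧
        (∀ z, ‖ν z - multiplier (loopDrift κ m M δ 0) (loopWeight κ m M δ 0) fun _ => z‖ ≤
          C * |η|) ∧
        (∀ θ w, loopWeight κ m M δ η θ w * (1 + η * (κ (liftPoint m M δ θ w) *
          (clamp m M w.2 * clamp m M w.2 * (1 - δ * cos θ)))) = clamp m M w.2 * clamp m M w.2) ∧
        ∀ z : ℝ × ℝ, z.2 ∈ Set.Ioo (2 * m) (M - m) → HasFDerivAt Φ ((2 * π) •
          ((ν z).2 • ContinuousLinearMap.fst ℝ ℝ ℝ - (ν z).1 • ContinuousLinearMap.snd ℝ ℝ ℝ)) z := by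
  obtain ⟨B, hB, L, hL, s₀, hs₀, η₁, hη₁, hdata⟩ :=
    exists_tameData_loop hκ hB₀ hL₀ hL₀' hm hmM hδ0 hδ
  obtain ⟨C₁, hC₁, hsol⟩ := TameData.exists_balanced_solutions hs₀ hL.le hB.le
  set C₂ := L / s₀ + L * B / s₀ ^ 2 with hC₂
  set C₃ := (1 / s₀ + B / s₀ ^ 2) * B with hC₃
  have hC₂0 : 0 < C₂ := by positivity
  have hC₃0 : 0 < C₃ := by positivity
  refine ⟨C₁ + C₂ * C₁ + C₃, by positivity, min η₁ (min (1 / 2) m / C₁), by positivity,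
    fun η hη0 hη => ?_⟩
  have hηC : C₁ * |η| ≤ min (1 / 2) m := by
    have := hη.trans (min_le_right _ _)
    rwa [le_div_iff₀ hC₁, mul_comm] at this
  obtain ⟨hT, hW, hdg, hds⟩ := hdata η (hη.trans (min_le_left _ _))
  obtain ⟨hT0, -⟩ := hdata 0 (by rw [abs_zero]; exact hη₁.le)
  obtain ⟨W, hWp, hWd, hWm, hWz, hWl⟩ := hsol _ _ hT η (hηC.trans (min_le_left _ _))
  set g := loopDrift κ m M δ η with hg
  set s := loopWeight κ m M δ η with hs
  have hWc : ∀ z, Continuous (W z) := fun z =>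
    continuous_iff_continuousAt.2 fun θ => (hWd z θ).continuousAt
  set ν : ℝ × ℝ → ℝ × ℝ := fun z => multiplier g s (W z) with hν
  have hνl : ∀ z z', ‖ν z - ν z'‖ ≤ C₂ * (2 * ‖z - z'‖) := fun z z' =>
    hT.norm_multiplier_sub_le hs₀ hL.le (hWc z) (hWc z') (hWl z z')
  set W' : ℝ × ℝ → ℝ → ℝ × ℝ := fun z θ => η • balancedDrift g s (W z) θ with hW'
  have hW'c : ∀ z, Continuous (W' z) := fun z => (hT.continuous_balancedDrift (hWc z)).const_smul η
  refine ⟨W, ν, fun z => η⁻¹ * loopAction κ δ η (W z) (W' z), hWp, hWd, fun z θ => ?_, ?_,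
    fun z => ?_, hW, fun z hz => ?_⟩
  · refine (hWz z θ).trans (mul_le_mul_of_nonneg_right ?_ (abs_nonneg η))
    linarith [mul_pos hC₂0 hC₁]
  · refine (LipschitzWith.of_dist_le_mul (K := (C₂ * 2).toNNReal) fun z z' => ?_).continuous
    rw [dist_eq_norm, dist_eq_norm, Real.coe_toNNReal _ (by positivity)]
    exact (hνl z z').trans_eq (by ring)
  · have h1 := hT.norm_multiplier_sub_le hs₀ hL.le (hWc z) (continuous_const (y := z)) (hWz z)
    have h2 := hT.norm_multiplier_sub_multiplier_le hT0 hs₀ (continuous_const (y := z))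
      (continuous_const (y := z)) (fun θ => hdg θ z) (fun θ => hds θ z)
    calc _ ≤ _ := norm_sub_le_norm_sub_add_norm_sub _ (multiplier g s fun _ => z) _
      _ ≤ C₂ * (C₁ * |η|) + (1 / s₀ + B / s₀ ^ 2) * (B * |η|) := add_le_add h1 h2
      _ ≤ _ := by
        rw [hC₃]
        nlinarith [mul_nonneg hC₁.le (abs_nonneg η)]
  · have hstrip : ∀ z : ℝ × ℝ, z.2 ∈ Set.Ioo (2 * m) (M - m) → ∀ θ, (W z θ).2 ∈ Set.Icc m M := by
      intro z hz θ
      have h1 : |(W z θ).2 - z.2| ≤ m :=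
        (norm_snd_le (W z θ - z)).trans ((hWz z θ).trans (hηC.trans (min_le_right _ _)))
      have h2 := abs_le.1 h1
      exact ⟨by linarith [hz.1], by linarith [hz.2]⟩
    set M₁ := |η| * (B + B * (B / s₀)) with hM₁
    set M₂ := |η| * ((L + L * (B / s₀) + B * (L / s₀ + L * B / s₀ ^ 2)) * 2) with hM₂
    have hM₂0 : 0 ≤ M₂ := by positivity
    set C := 2 * π * ((|η| * (9 * (B₀ + 2 * L₀ * (2 * M₁ + M))) + (1 / m ^ 2 + M₁ / m ^ 3)) *
      (2 + M₂) ^ 2) with hC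
    have key : ∀ z' : ℝ × ℝ, z'.2 ∈ Set.Ioo (2 * m) (M - m) →
        |loopAction κ δ η (W z') (W' z') - loopAction κ δ η (W z) (W' z) -
          2 * π * ((η • ν z).2 * (z' - z).1 - (η • ν z).1 * (z' - z).2)| ≤ C * ‖z' - z‖ ^ 2 := by
      intro z' hz'
      have hn : 0 ≤ ‖z' - z‖ := norm_nonneg _
      refine (abs_loopAction_sub_le hκ (M := M₁) (N := M) (d := (2 + M₂) * ‖z' - z‖) hB₀ hL₀ hL₀' hm
        hδ0 hδ (hWd z) (hWd z') (hW'c z) (hW'c z') (hWp z) (hWp z') (fun θ => (hstrip z hz θ).1)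
        (fun θ => (hstrip z' hz' θ).1) (fun θ => (hstrip z hz θ).2) (fun θ => ?_) (fun θ => ?_)
        (fun θ => ?_) (fun θ => ?_) (fun θ => ?_) ?_).trans_eq ?_
      · rw [norm_smul, Real.norm_eq_abs]
        exact mul_le_mul_of_nonneg_left (hT.norm_balancedDrift_le hs₀ (hWc z) θ) (abs_nonneg η)
      · exact (hWl z' z θ).trans (mul_le_mul_of_nonneg_right (by linarith) hn)
      · rw [← smul_sub, norm_smul, Real.norm_eq_abs]
        have := mul_le_mul_of_nonneg_left (hT.norm_balancedDrift_sub_le hs₀ hL.le (hWc z') (hWc z)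
          (hWl z' z) θ) (abs_nonneg η)
        rw [hM₂]
        linarith
      · have h1 := hW θ (W z θ)
        have hy := hm.trans_le (hstrip z hz θ).1
        rw [clamp_of_mem (hstrip z hz θ), ← liftCurve_eq_liftPoint (hstrip z hz θ)] at h1
        simp only [balancedDrift, hg, loopDrift, clamp_of_mem (hstrip z hz θ),
          ← liftCurve_eq_liftPoint (hstrip z hz θ), Prod.smul_fst, Prod.fst_sub, smul_eq_mul]
        simp only [← hg, ← hs, hν]
        generalize κ (liftCurve δ (W z) θ) = k at h1 ⊢
        generalize s θ (W z θ) = σ at h1 ⊢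
        generalize (W z θ).2 = y at h1 hy ⊢
        field_simp
        linear_combination (-k * δ * y * (cos θ - δ) - (multiplier g s (W z)).1) * h1
      · have h1 := hW θ (W z θ)
        have hy := hm.trans_le (hstrip z hz θ).1
        rw [clamp_of_mem (hstrip z hz θ), ← liftCurve_eq_liftPoint (hstrip z hz θ)] at h1
        simp only [liftDeriv, balancedDrift, hg, loopDrift, clamp_of_mem (hstrip z hz θ),
          ← liftCurve_eq_liftPoint (hstrip z hz θ), Prod.smul_snd, Prod.snd_sub, smul_eq_mul]
        simp only [← hg, ← hs, hν]
        generalize κ (liftCurve δ (W z) θ) = k at h1 ⊢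
        generalize s θ (W z θ) = σ at h1 ⊢
        generalize (W z θ).2 = y at h1 hy ⊢
        field_simp
        linear_combination (-k * δ * y * sin θ - (multiplier g s (W z)).2) * h1
      · rw [intervalIntegral.integral_sub ((hWc z').intervalIntegrable _ _)
          ((hWc z).intervalIntegrable _ _), hWm, hWm, smul_sub]
      · rw [hC]; ring
    set Λ : ℝ × ℝ →L[ℝ] ℝ := (2 * π) •
      ((ν z).2 • ContinuousLinearMap.fst ℝ ℝ ℝ - (ν z).1 • ContinuousLinearMap.snd ℝ ℝ ℝ) with hΛ
    set Φ : ℝ × ℝ → ℝ := fun z => η⁻¹ * loopAction κ δ η (W z) (W' z) with hΦ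
    have hO : (fun z' => Φ z' - Φ z - Λ (z' - z)) =O[𝓝 z] fun z' => ‖z' - z‖ ^ 2 := by
      refine Asymptotics.IsBigO.of_bound (|η⁻¹| * C) ?_
      filter_upwards [(isOpen_Ioo.preimage continuous_snd).mem_nhds hz] with z' hz'
      have e : Φ z' - Φ z - Λ (z' - z) = η⁻¹ * (loopAction κ δ η (W z') (W' z') -
          loopAction κ δ η (W z) (W' z) -
          2 * π * ((η • ν z).2 * (z' - z).1 - (η • ν z).1 * (z' - z).2)) := by
        simp [hΦ, hΛ]
        field_simp
      rw [e, norm_mul, Real.norm_eq_abs, Real.norm_eq_abs, norm_pow, norm_norm, mul_assoc |η⁻¹|]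
      exact mul_le_mul_of_nonneg_left (key z' hz') (abs_nonneg _)
    have h0 := (hO.hasFDerivAt one_lt_two).add (Λ.hasFDerivAt (x := z))
    rw [zero_add] at h0
    refine (h0.add_const (Φ z - Λ z)).congr_of_eventuallyEq (Eventually.of_forall fun z' => ?_)
    simp only [Pi.add_apply, map_sub]
    ring

/-- The height-to-radius factor and its square are close to one for small `δ`. -/
theorem abs_inv_sq_sub_one_le {δ : ℝ} (hδ0 : 0 ≤ δ) (hδ : δ ≤ 1 / 2) (θ : ℝ) :
    0 < 1 - δ * cos θ ∧ ((1 - δ * cos θ) ^ 2)⁻¹ ≤ 4 ∧ |((1 - δ * cos θ) ^ 2)⁻¹ - 1| ≤ 10 * δ := by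
  have hc := abs_le.1 (abs_cos_le_one θ)
  have h1 : |δ * cos θ| ≤ δ := by
    rw [abs_mul, abs_of_nonneg hδ0]; exact mul_le_of_le_one_right hδ0 (abs_cos_le_one θ)
  have h2 := abs_le.1 h1
  set t := δ * cos θ with ht
  have hρ : 1 / 2 ≤ 1 - t := by linarith
  have hi : ((1 - t) ^ 2)⁻¹ ≤ 4 := by
    rw [inv_le_comm₀ (by positivity) (by norm_num)]
    nlinarith
  refine ⟨by linarith, hi, ?_⟩
  have e : ((1 - t) ^ 2)⁻¹ - 1 = t * (2 - t) * ((1 - t) ^ 2)⁻¹ := by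
    have : 1 - t ≠ 0 := by linarith
    field_simp
    ring
  have h3 : |2 - t| ≤ 5 / 2 := abs_le.2 ⟨by linarith, by linarith⟩
  rw [e, abs_mul, abs_mul, abs_of_nonneg (by positivity : 0 ≤ ((1 - t) ^ 2)⁻¹)]
  calc |t| * |2 - t| * ((1 - t) ^ 2)⁻¹ ≤ δ * (5 / 2) * 4 := by gcongr
    _ = _ := by ring

theorem integral_sin_mul_inv_sq {δ : ℝ} (hδ0 : 0 < δ) (hδ : δ ≤ 1 / 2) :
    ∫ θ in (0 : ℝ)..(2 * π), sin θ * ((1 - δ * cos θ) ^ 2)⁻¹ = 0 := by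
  have hne : ∀ θ, 1 - δ * cos θ ≠ 0 := fun θ => (abs_inv_sq_sub_one_le hδ0.le hδ θ).1.ne'
  have hd : ∀ θ ∈ Set.uIcc (0 : ℝ) (2 * π), HasDerivAt (fun θ => -(δ⁻¹ * (1 - δ * cos θ)⁻¹))
      (sin θ * ((1 - δ * cos θ) ^ 2)⁻¹) θ := fun θ _ => by
    refine ((((((hasDerivAt_cos θ).const_mul δ).const_sub 1).inv (hne θ)).const_mul
      δ⁻¹).neg).congr_deriv ?_
    have := hne θ
    field_simp
  rw [intervalIntegral.integral_eq_sub_of_hasDerivAt hd]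
  · simp
  · refine Continuous.intervalIntegrable ?_ _ _
    exact continuous_sin.mul (Continuous.inv₀ (by fun_prop) fun θ => pow_ne_zero 2 (hne θ))

theorem integral_cos_sub_mul_inv_sq {δ : ℝ} (hδ0 : 0 ≤ δ) (hδ : δ ≤ 1 / 2) :
    ∫ θ in (0 : ℝ)..(2 * π), (cos θ - δ) * ((1 - δ * cos θ) ^ 2)⁻¹ = 0 := by
  have hne : ∀ θ, 1 - δ * cos θ ≠ 0 := fun θ => (abs_inv_sq_sub_one_le hδ0 hδ θ).1.ne'
  have hd : ∀ θ ∈ Set.uIcc (0 : ℝ) (2 * π), HasDerivAt (fun θ => sin θ * (1 - δ * cos θ)⁻¹)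
      ((cos θ - δ) * ((1 - δ * cos θ) ^ 2)⁻¹) θ := fun θ _ => by
    refine ((hasDerivAt_sin θ).mul
      ((((hasDerivAt_cos θ).const_mul δ).const_sub 1).inv (hne θ))).congr_deriv ?_
    have := hne θ
    simp only [Pi.inv_apply]
    field_simp
    linear_combination (-δ * ((1 - δ * cos θ) ^ 2)⁻¹) * sin_sq_add_cos_sq θ
  rw [intervalIntegral.integral_eq_sub_of_hasDerivAt hd]
  · simp
  · refine Continuous.intervalIntegrable ?_ _ _
    exact (by fun_prop : Continuous fun θ => cos θ - δ).mul
      (Continuous.inv₀ (by fun_prop) fun θ => pow_ne_zero 2 (hne θ))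

/-- First moments of a function close to `c + δ (p sin θ - q cos θ)`. -/
theorem abs_integral_moment_sub_le {f : ℝ → ℝ} (hf : Continuous f) {c p q ω δ : ℝ} (hδ0 : 0 < δ)
    (hδ : δ ≤ 1 / 2) (h : ∀ θ, |f θ - c - δ * (p * sin θ - q * cos θ)| ≤ ω * δ) :
    |(∫ θ in (0 : ℝ)..(2 * π), f θ * ((cos θ - δ) * ((1 - δ * cos θ) ^ 2)⁻¹)) + π * δ * q| ≤
      2 * π * (δ * (6 * ω + 16 * δ * (|p| + |q|))) ∧
    |(∫ θ in (0 : ℝ)..(2 * π), f θ * (sin θ * ((1 - δ * cos θ) ^ 2)⁻¹)) - π * δ * p| ≤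
      2 * π * (δ * (6 * ω + 16 * δ * (|p| + |q|))) := by
  have hρ := abs_inv_sq_sub_one_le hδ0.le hδ
  have hcont : Continuous fun θ => ((1 - δ * cos θ) ^ 2)⁻¹ :=
    Continuous.inv₀ (by fun_prop) fun θ => pow_ne_zero 2 (hρ θ).1.ne'
  have hω : 0 ≤ ω * δ := (abs_nonneg _).trans (h 0)
  have hlin : ∀ θ, |p * sin θ - q * cos θ| ≤ |p| + |q| := fun θ => by
    refine (abs_sub _ _).trans ?_
    rw [abs_mul, abs_mul]
    exact add_le_add (mul_le_of_le_one_right (abs_nonneg _) (abs_sin_le_one θ))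
      (mul_le_of_le_one_right (abs_nonneg _) (abs_cos_le_one θ))
  have main : ∀ a b : ℝ → ℝ, Continuous a → Continuous b → (∀ θ, |a θ| ≤ 3 / 2) →
      (∀ θ, |a θ * ((1 - δ * cos θ) ^ 2)⁻¹ - b θ| ≤ 16 * δ) →
      ∫ θ in (0 : ℝ)..(2 * π), a θ * ((1 - δ * cos θ) ^ 2)⁻¹ = 0 →
      |(∫ θ in (0 : ℝ)..(2 * π), f θ * (a θ * ((1 - δ * cos θ) ^ 2)⁻¹)) -
        δ * ∫ θ in (0 : ℝ)..(2 * π), (p * sin θ - q * cos θ) * b θ| ≤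
      2 * π * (δ * (6 * ω + 16 * δ * (|p| + |q|))) := by
    intro a b ha hb ha1 hab h0
    have e : (∫ θ in (0 : ℝ)..(2 * π), f θ * (a θ * ((1 - δ * cos θ) ^ 2)⁻¹)) -
        δ * ∫ θ in (0 : ℝ)..(2 * π), (p * sin θ - q * cos θ) * b θ =
        ∫ θ in (0 : ℝ)..(2 * π), (f θ * (a θ * ((1 - δ * cos θ) ^ 2)⁻¹) -
          c * (a θ * ((1 - δ * cos θ) ^ 2)⁻¹) - δ * ((p * sin θ - q * cos θ) * b θ)) := by
      rw [intervalIntegral.integral_sub, intervalIntegral.integral_sub,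
        intervalIntegral.integral_const_mul, intervalIntegral.integral_const_mul, h0]
      · ring
      all_goals exact Continuous.intervalIntegrable (by fun_prop) _ _
    rw [e]
    have hbd := intervalIntegral.norm_integral_le_of_norm_le_const (a := 0) (b := 2 * π)
      (C := δ * (6 * ω + 16 * δ * (|p| + |q|)))
      (f := fun θ => f θ * (a θ * ((1 - δ * cos θ) ^ 2)⁻¹) -
          c * (a θ * ((1 - δ * cos θ) ^ 2)⁻¹) - δ * ((p * sin θ - q * cos θ) * b θ)) fun θ _ => by
        have i1 := (hρ θ).2.1
        have i0 : 0 ≤ ((1 - δ * cos θ) ^ 2)⁻¹ := by positivity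
        have e2 : f θ * (a θ * ((1 - δ * cos θ) ^ 2)⁻¹) -
          c * (a θ * ((1 - δ * cos θ) ^ 2)⁻¹) - δ * ((p * sin θ - q * cos θ) * b θ) =
          (f θ - c - δ * (p * sin θ - q * cos θ)) * a θ * ((1 - δ * cos θ) ^ 2)⁻¹ +
          δ * (p * sin θ - q * cos θ) * (a θ * ((1 - δ * cos θ) ^ 2)⁻¹ - b θ) := by ring
        rw [e2, Real.norm_eq_abs]
        refine (abs_add_le _ _).trans ?_
        rw [abs_mul, abs_mul, abs_mul, abs_mul, abs_of_nonneg i0, abs_of_pos hδ0]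
        calc _ ≤ ω * δ * (3 / 2) * 4 + δ * (|p| + |q|) * (16 * δ) := by
              gcongr
              exacts [h θ, ha1 θ, hlin θ, hab θ]
          _ = _ := by ring
    rw [sub_zero, abs_of_pos two_pi_pos, Real.norm_eq_abs] at hbd
    exact hbd.trans_eq (mul_comm _ _)
  have isc : ∫ θ in (0 : ℝ)..(2 * π), sin θ * cos θ = 0 := by
    rw [integral_sin_mul_cos₁]; simp
  have iss : ∫ θ in (0 : ℝ)..(2 * π), sin θ ^ 2 = π := by
    rw [integral_sin_sq]; simp
  have icc : ∫ θ in (0 : ℝ)..(2 * π), cos θ ^ 2 = π := by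
    rw [integral_cos_sq]; simp
  constructor
  · have h1 := main (fun θ => cos θ - δ) cos (by fun_prop) continuous_cos
      (fun θ => by
        have := abs_le.1 (abs_cos_le_one θ)
        exact abs_le.2 ⟨by linarith, by linarith⟩)
      (fun θ => by
        have i1 := abs_le.1 (hρ θ).2.2
        have i2 := abs_le.1 (abs_cos_le_one θ)
        have i3 : |cos θ - δ| ≤ 3 / 2 := abs_le.2 ⟨by linarith, by linarith⟩
        have e : (cos θ - δ) * ((1 - δ * cos θ) ^ 2)⁻¹ - cos θ =
          (cos θ - δ) * (((1 - δ * cos θ) ^ 2)⁻¹ - 1) + -δ := by ring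
        rw [e]
        refine (abs_add_le _ _).trans ?_
        rw [abs_mul, abs_neg, abs_of_pos hδ0]
        have := mul_le_mul i3 (hρ θ).2.2 (abs_nonneg _) (by norm_num)
        linarith)
      (integral_cos_sub_mul_inv_sq hδ0.le hδ)
    have e : ∫ θ in (0 : ℝ)..(2 * π), (p * sin θ - q * cos θ) * cos θ = -(π * q) := by
      have : ∀ θ, (p * sin θ - q * cos θ) * cos θ = p * (sin θ * cos θ) - q * cos θ ^ 2 :=
        fun θ => by ring
      simp only [this]
      rw [intervalIntegral.integral_sub, intervalIntegral.integral_const_mul,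
        intervalIntegral.integral_const_mul, isc, icc]
      · ring
      all_goals exact Continuous.intervalIntegrable (by fun_prop) _ _
    rw [e] at h1
    convert h1 using 2
    ring
  · have h1 := main sin sin continuous_sin continuous_sin
      (fun θ => (abs_sin_le_one θ).trans (by norm_num))
      (fun θ => by
        have e : sin θ * ((1 - δ * cos θ) ^ 2)⁻¹ - sin θ =
          sin θ * (((1 - δ * cos θ) ^ 2)⁻¹ - 1) := by ring
        rw [e, abs_mul]
        have := mul_le_mul (abs_sin_le_one θ) (hρ θ).2.2 (abs_nonneg _) (by norm_num)
        linarith)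
      (integral_sin_mul_inv_sq hδ0 hδ)
    have e : ∫ θ in (0 : ℝ)..(2 * π), (p * sin θ - q * cos θ) * sin θ = π * p := by
      have : ∀ θ, (p * sin θ - q * cos θ) * sin θ = p * sin θ ^ 2 - q * (sin θ * cos θ) :=
        fun θ => by ring
      simp only [this]
      rw [intervalIntegral.integral_sub, intervalIntegral.integral_const_mul,
        intervalIntegral.integral_const_mul, isc, iss]
      · ring
      all_goals exact Continuous.intervalIntegrable (by fun_prop) _ _
    rw [e] at h1
    convert h1 using 2
    ring

/-- The unperturbed multiplier at a point where `κ y²` has a first-order expansion. -/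
theorem abs_multiplier_sub_le {κ : ℝ × ℝ → ℝ} (hκ : Continuous κ) {m M δ c a b ω : ℝ}
    {z : ℝ × ℝ} (hm : 0 < m) (hz : z.2 ∈ Set.Icc m M) (hδ0 : 0 < δ) (hδ : δ ≤ 1 / 2)
    (h : ∀ θ, |κ (liftPoint m M δ θ z) * (liftPoint m M δ θ z).2 ^ 2 - c -
      δ * (z.2 * a * sin θ - z.2 * b * cos θ)| ≤ ω * z.2 * δ) :
    |2 / δ ^ 2 * (multiplier (loopDrift κ m M δ 0) (loopWeight κ m M δ 0) fun _ => z).1 - b| ≤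
      2 * (6 * ω + 16 * δ * (|a| + |b|)) ∧
    |2 / δ ^ 2 * (multiplier (loopDrift κ m M δ 0) (loopWeight κ m M δ 0) fun _ => z).2 + a| ≤
      2 * (6 * ω + 16 * δ * (|a| + |b|)) := by
  obtain ⟨x, y⟩ := z
  dsimp only at hz h ⊢
  have hy : 0 < y := hm.trans_le hz.1
  have hlift : Continuous fun θ => liftPoint m M δ θ (x, y) := by unfold liftPoint; fun_prop
  have hκl : Continuous fun θ => κ (liftPoint m M δ θ (x, y)) := hκ.comp hlift
  set f : ℝ → ℝ := fun θ => κ (liftPoint m M δ θ (x, y)) * (liftPoint m M δ θ (x, y)).2 ^ 2 with hf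
  have hfc : Continuous f := hκl.mul ((continuous_snd.comp hlift).pow 2)
  obtain ⟨h1, h2⟩ := abs_integral_moment_sub_le hfc hδ0 hδ h
  have hg : ∀ θ, loopDrift κ m M δ 0 θ (x, y) =
      ((-δ * y) * (f θ * ((cos θ - δ) * ((1 - δ * cos θ) ^ 2)⁻¹)),
        (-δ * y) * (f θ * (sin θ * ((1 - δ * cos θ) ^ 2)⁻¹))) := fun θ => by
    have hρ := (abs_inv_sq_sub_one_le hδ0.le hδ θ).1.ne'
    have e : (liftPoint m M δ θ (x, y)).2 = y * (1 - δ * cos θ) := by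
      simp only [liftPoint, clamp_of_mem hz]
    simp only [loopDrift, loopWeight, hf, e, clamp_of_mem hz, zero_mul, add_zero, inv_one, mul_one,
      Prod.smul_mk, smul_eq_mul]
    ext <;> field_simp
  have hs : ∀ θ, loopWeight κ m M δ 0 θ (x, y) = y ^ 2 := fun θ => by
    simp only [loopWeight, clamp_of_mem hz, zero_mul, add_zero, inv_one, mul_one, sq]
  have hcont : Continuous fun θ => ((1 - δ * cos θ) ^ 2)⁻¹ :=
    Continuous.inv₀ (by fun_prop) fun θ =>
      pow_ne_zero 2 (abs_inv_sq_sub_one_le hδ0.le hδ θ).1.ne'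
  have hprod : ∀ F G : ℝ → ℝ, Continuous F → Continuous G →
      ∫ θ in (0 : ℝ)..(2 * π), (F θ, G θ) =
        (∫ θ in (0 : ℝ)..(2 * π), F θ, ∫ θ in (0 : ℝ)..(2 * π), G θ) := fun F G hF hG => by
    have hi : IntervalIntegrable (fun θ => (F θ, G θ)) volume 0 (2 * π) :=
      (hF.prodMk hG).intervalIntegrable _ _
    ext
    · exact ((ContinuousLinearMap.fst ℝ ℝ ℝ).intervalIntegral_comp_comm hi).symm
    · exact ((ContinuousLinearMap.snd ℝ ℝ ℝ).intervalIntegral_comp_comm hi).symm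
  simp only [multiplier, hg, hs]
  rw [hprod _ _ (by fun_prop) (by fun_prop)]
  simp only [intervalIntegral.integral_const_mul, intervalIntegral.integral_const, Prod.smul_mk,
    smul_eq_mul, sub_zero]
  set I := ∫ θ in (0 : ℝ)..(2 * π), f θ * ((cos θ - δ) * ((1 - δ * cos θ) ^ 2)⁻¹)
  set J := ∫ θ in (0 : ℝ)..(2 * π), f θ * (sin θ * ((1 - δ * cos θ) ^ 2)⁻¹)
  have hpos : 0 < π * δ * y := by positivity
  have e0 : 2 * π * (δ * (6 * (ω * y) + 16 * δ * (|y * a| + |y * b|))) =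
      π * δ * y * (2 * (6 * ω + 16 * δ * (|a| + |b|))) := by
    rw [abs_mul, abs_mul, abs_of_pos hy]; ring
  have hπ := pi_ne_zero
  rw [e0] at h1 h2
  constructor
  · have e : I + π * δ * (y * b) =
        -(π * δ * y) * (2 / δ ^ 2 * ((2 * π * y ^ 2)⁻¹ * (-δ * y * I)) - b) := by
      field_simp; ring
    rw [e, abs_mul, abs_neg, abs_of_pos hpos] at h1
    exact le_of_mul_le_mul_left h1 hpos
  · have e : J - π * δ * (y * a) =
        -(π * δ * y) * (2 / δ ^ 2 * ((2 * π * y ^ 2)⁻¹ * (-δ * y * J)) + a) := by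
      field_simp; ring
    rw [e, abs_mul, abs_neg, abs_of_pos hpos] at h2
    exact le_of_mul_le_mul_left h2 hpos

/-- A `C¹` function has a uniform first-order expansion on compact convex sets. -/
theorem ContDiffOn.exists_uniform_expansion {E : Type*} [NormedAddCommGroup E] [NormedSpace ℝ E]
    {K : E → ℝ} {U Q : Set E} (hU : IsOpen U) (hK : ContDiffOn ℝ 1 K U) (hQ : IsCompact Q)
    (hQc : Convex ℝ Q) (hQU : Q ⊆ U) {ω : ℝ} (hω : 0 < ω) :
    ∃ d > (0 : ℝ), ∀ p ∈ Q, ∀ q ∈ Q, ‖q - p‖ ≤ d →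
      |K q - K p - fderiv ℝ K p (q - p)| ≤ ω * ‖q - p‖ := by
  have hc : ContinuousOn (fderiv ℝ K) Q := (hK.continuousOn_fderiv_of_isOpen hU le_rfl).mono hQU
  obtain ⟨d, hd, hu⟩ := Metric.uniformContinuousOn_iff.1
    (hQ.uniformContinuousOn_of_continuous hc) ω hω
  refine ⟨d / 2, half_pos hd, fun p hp q hq hpq => ?_⟩
  have hseg : segment ℝ p q ⊆ Q := hQc.segment_subset hp hq
  rw [← Real.norm_eq_abs]
  refine Convex.norm_image_sub_le_of_norm_fderiv_le' (f := K) (𝕜 := ℝ) (s := segment ℝ p q)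
    (fun x hx => ?_) (fun x hx => ?_) (convex_segment p q) (left_mem_segment ℝ p q) (right_mem_segment ℝ p q)
  · exact (hK.differentiableOn one_ne_zero).differentiableAt (hU.mem_nhds (hQU (hseg hx)))
  · rw [← dist_eq_norm]
    refine (hu x (hseg hx) p hp ?_).le
    have h1 : x ∈ Metric.closedBall p (d / 2) :=
      (convex_closedBall p (d / 2)).segment_subset (Metric.mem_closedBall_self (half_pos hd).le)
        (by rwa [mem_closedBall_iff_norm]) hx
    exact (Metric.mem_closedBall.1 h1).trans_lt (half_lt_self hd)

/-- The density `K / y²` agrees on a box with a globally bounded Lipschitz function. -/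
theorem exists_lipschitz_density {K : ℝ × ℝ → ℝ} (hK : ContDiffOn ℝ 1 K {z : ℝ × ℝ | 0 < z.2})
    {R m M : ℝ} (hR : 0 ≤ R) (hm : 0 < m) (hmM : m ≤ M) :
    ∃ (κ : ℝ × ℝ → ℝ) (B L : ℝ), Continuous κ ∧ (∀ p, |κ p| ≤ B) ∧
      (∀ p p', |κ p - κ p'| ≤ L * ‖p - p'‖) ∧ 0 ≤ L ∧
      ∀ p ∈ Set.Icc (-R) R ×ˢ Set.Icc m M, κ p * p.2 ^ 2 = K p := by
  set Q : Set (ℝ × ℝ) := Set.Icc (-R) R ×ˢ Set.Icc m M with hQ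
  have hQU : Q ⊆ {z : ℝ × ℝ | 0 < z.2} := fun p hp => hm.trans_le hp.2.1
  have hf : ContDiffOn ℝ 1 (fun p => K p / p.2 ^ 2) Q :=
    (hK.mono hQU).div (contDiff_snd.pow 2).contDiffOn fun p hp => (pow_pos (hQU hp) 2).ne'
  obtain ⟨L, hL⟩ := hf.exists_lipschitzOnWith one_ne_zero
    ((convex_Icc _ _).prod (convex_Icc _ _)) (isCompact_Icc.prod isCompact_Icc)
  obtain ⟨B, hB⟩ := (isCompact_Icc.prod isCompact_Icc).exists_bound_of_continuousOn hf.continuousOn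
  set r : ℝ × ℝ → ℝ × ℝ := fun p => (clamp (-R) R p.1, clamp m M p.2) with hr
  have hrQ : ∀ p, r p ∈ Q := fun p => ⟨clamp_mem (by linarith) _, clamp_mem hmM _⟩
  have hrl : ∀ p p', ‖r p - r p'‖ ≤ ‖p - p'‖ := fun p p' => by
    rw [Prod.norm_def, Prod.norm_def]
    exact max_le_max (abs_clamp_sub_clamp_le _ _ _ _) (abs_clamp_sub_clamp_le _ _ _ _)
  have hl : ∀ p p', |K (r p) / (r p).2 ^ 2 - K (r p') / (r p').2 ^ 2| ≤ L * ‖p - p'‖ :=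
    fun p p' => by
      have := hL.dist_le_mul (r p) (hrQ p) (r p') (hrQ p')
      rw [dist_eq_norm, dist_eq_norm] at this
      exact this.trans (mul_le_mul_of_nonneg_left (hrl p p') L.2)
  refine ⟨fun p => K (r p) / (r p).2 ^ 2, B, L, ?_, fun p => hB _ (hrQ p), hl, L.2, fun p hp => ?_⟩
  · refine (LipschitzWith.of_dist_le_mul (K := L) fun p p' => ?_).continuous
    rw [dist_eq_norm, dist_eq_norm]
    exact hl p p'
  · have e : r p = p := Prod.ext (clamp_of_mem hp.1) (clamp_of_mem hp.2)
    have hp2 : p.2 ≠ 0 := (hm.trans_le hp.2.1).ne'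
    simp only [e]
    field_simp

/-- Periodic solutions of the drift equation lift to embedded loops. -/
theorem exists_embedded_loop_of_drift {K κ : ℝ × ℝ → ℝ} (hκ : Continuous κ) {m M k δ ε η : ℝ}
    (hm : 0 < m) (hδ0 : 0 < δ) (hδ : δ ≤ 1 / 2) (hkδ : k * δ = 1) (hεη : ε * δ = η)
    {w : ℝ → ℝ × ℝ} (hw : ∀ θ, HasDerivAt w (η • loopDrift κ m M δ η θ (w θ)) θ)
    (hwp : Function.Periodic w (2 * π)) (hstrip : ∀ θ, (w θ).2 ∈ Set.Icc m M)
    (hweight : ∀ θ w, loopWeight κ m M δ η θ w * (1 + η * (κ (liftPoint m M δ θ w) *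
      (clamp m M w.2 * clamp m M w.2 * (1 - δ * cos θ)))) = clamp m M w.2 * clamp m M w.2)
    (hK : ∀ θ, κ (liftCurve δ w θ) * (liftCurve δ w θ).2 ^ 2 = K (liftCurve δ w θ))
    (hgt : ∀ θ, cos θ < k + ε * K (liftCurve δ w θ)) :
    ∃ u : ℝ → ℝ × ℝ, IsKLoop (fun z => k + ε * K z) u ∧ IsEmbedded u := by
  have hρ := fun θ => (abs_inv_sq_sub_one_le hδ0.le hδ θ).1
  have hd := fun θ => hasDerivAt_liftCurve δ (w' := fun θ => η • loopDrift κ m M δ η θ (w θ)) (hw θ)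
  have hper := periodic_liftCurve δ hwp
  have hlc : Continuous (liftCurve δ w) :=
    continuous_iff_continuousAt.2 fun θ => (hd θ).continuousAt
  have hk : k = δ⁻¹ := eq_inv_of_mul_eq_one_left hkδ
  have hε : ε = η * δ⁻¹ := by rw [← hεη]; field_simp
  have hD : ∀ θ, 1 + η * (κ (liftCurve δ w θ) * ((w θ).2 * (w θ).2 * (1 - δ * cos θ))) ≠ 0 ∧
      loopWeight κ m M δ η θ (w θ) = (w θ).2 * (w θ).2 /
        (1 + η * (κ (liftCurve δ w θ) * ((w θ).2 * (w θ).2 * (1 - δ * cos θ)))) := fun θ => by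
    have h1 := hweight θ (w θ)
    have hy := hm.trans_le (hstrip θ).1
    rw [clamp_of_mem (hstrip θ), ← liftCurve_eq_liftPoint (hstrip θ)] at h1
    have hne : 1 + η * (κ (liftCurve δ w θ) * ((w θ).2 * (w θ).2 * (1 - δ * cos θ))) ≠ 0 := by
      intro h0
      rw [h0, mul_zero] at h1
      exact (mul_pos hy hy).ne h1
    exact ⟨hne, by rw [eq_div_iff hne, h1]⟩
  have hspeed : ∀ θ, (liftCurve δ w θ).2 / (k + ε * K (liftCurve δ w θ) - cos θ) =
      δ * (w θ).2 /
        (1 + η * (κ (liftCurve δ w θ) * ((w θ).2 * (w θ).2 * (1 - δ * cos θ)))) := fun θ => by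
    have h1 := (hD θ).1
    have h2 := (hρ θ).ne'
    have e : k + ε * K (liftCurve δ w θ) - cos θ = (1 - δ * cos θ) *
        (1 + η * (κ (liftCurve δ w θ) * ((w θ).2 * (w θ).2 * (1 - δ * cos θ)))) / δ := by
      rw [← hK, hk, hε, show (liftCurve δ w θ).2 = (w θ).2 * (1 - δ * cos θ) from rfl]
      field_simp
      ring
    rw [e, show (liftCurve δ w θ).2 = (w θ).2 * (1 - δ * cos θ) from rfl]
    field_simp
  refine exists_embedded_loop_of_tangentAngle (κ := fun z => k + ε * K z)
    (x := fun θ => (liftCurve δ w θ).1) (Y := fun θ => (liftCurve δ w θ).2) ?_ (fun θ => ?_)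
    (fun θ => ?_) (fun θ => congrArg Prod.fst (hper θ)) (fun θ => congrArg Prod.snd (hper θ))
    (fun θ => mul_pos (hm.trans_le (hstrip θ).1) (hρ θ)) hgt
  · simp only [Prod.mk.eta, ← hK]
    exact continuous_const.add (continuous_const.mul ((hκ.comp hlc).mul (hlc.snd.pow 2)))
  · have h1 : HasDerivAt (fun θ => (liftCurve δ w θ).1) _ θ := (hd θ).fst
    refine h1.congr_deriv ?_
    simp only [Prod.mk.eta, hspeed, liftDeriv, loopDrift, (hD θ).2, clamp_of_mem (hstrip θ),
      ← liftCurve_eq_liftPoint (hstrip θ), Prod.smul_fst, Prod.smul_snd, smul_eq_mul]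
    have hne := (hD θ).1
    have hy := (hm.trans_le (hstrip θ).1).ne'
    generalize κ (liftCurve δ w θ) = q at hne ⊢
    generalize (w θ).2 = y at hne hy ⊢
    generalize hDe : 1 + η * (q * (y * y * (1 - δ * cos θ))) = D at hne ⊢
    field_simp
    linear_combination -cos θ * hDe - (η * q * δ * y ^ 2) * sin_sq_add_cos_sq θ
  · have h1 : HasDerivAt (fun θ => (liftCurve δ w θ).2) _ θ := (hd θ).snd
    refine h1.congr_deriv ?_
    simp only [Prod.mk.eta, hspeed, liftDeriv, loopDrift, (hD θ).2, clamp_of_mem (hstrip θ),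
      ← liftCurve_eq_liftPoint (hstrip θ), Prod.smul_snd, smul_eq_mul]
    have hne := (hD θ).1
    have hy := (hm.trans_le (hstrip θ).1).ne'
    generalize κ (liftCurve δ w θ) = q at hne ⊢
    generalize (w θ).2 = y at hne hy ⊢
    generalize hDe : 1 + η * (q * (y * y * (1 - δ * cos θ))) = D at hne ⊢
    field_simp
    linear_combination -sin θ * hDe

theorem liftPoint_mem_box {m M R δ θ : ℝ} {w : ℝ × ℝ} (hm : 0 < m) (hδ0 : 0 ≤ δ) (hδ : δ ≤ 1 / 2)
    (hw1 : |w.1| ≤ R + M) (hw2 : w.2 ∈ Set.Icc m M) :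
    liftPoint m M δ θ w ∈ Set.Icc (-(R + 2 * M)) (R + 2 * M) ×ˢ Set.Icc (m / 2) (2 * M) := by
  have hy : 0 < w.2 := hm.trans_le hw2.1
  have aux : ∀ e, |e| ≤ 1 → |δ * w.2 * e| ≤ w.2 / 2 := fun e he => by
    rw [abs_mul, abs_of_nonneg (by positivity : 0 ≤ δ * w.2)]
    nlinarith [mul_le_of_le_one_right (by positivity : 0 ≤ δ * w.2) he]
  have h1 := abs_le.1 (aux _ (abs_sin_le_one θ))
  have h2 := abs_le.1 (aux _ (abs_cos_le_one θ))
  have h3 := abs_le.1 hw1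
  have h4 := hw2.1
  have h5 := hw2.2
  rw [liftPoint, clamp_of_mem hw2]
  refine ⟨⟨?_, ?_⟩, ?_, ?_⟩ <;> dsimp only <;> nlinarith

/-- As `δ → 0` the rescaled unperturbed multiplier converges uniformly on boxes to the rotated
gradient of `K`. -/
theorem exists_multiplier_close {K : ℝ × ℝ → ℝ} (hK : ContDiffOn ℝ 1 K {z : ℝ × ℝ | 0 < z.2})
    {R m M e : ℝ} (hm : 0 < m) (hmM : m ≤ M) (he : 0 < e) :
    ∃ δ₀ > (0 : ℝ), δ₀ ≤ 1 / 2 ∧ ∀ δ : ℝ, 0 < δ → δ ≤ δ₀ → ∀ κ : ℝ × ℝ → ℝ, Continuous κ →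
      (∀ p ∈ Set.Icc (-(R + 2 * M)) (R + 2 * M) ×ˢ Set.Icc (m / 2) (2 * M),
        κ p * p.2 ^ 2 = K p) →
      ∀ z : ℝ × ℝ, |z.1| ≤ R → z.2 ∈ Set.Icc m M →
        |2 / δ ^ 2 * (multiplier (loopDrift κ m M δ 0) (loopWeight κ m M δ 0) fun _ => z).1 -
          fderiv ℝ K z (0, 1)| ≤ e ∧
        |2 / δ ^ 2 * (multiplier (loopDrift κ m M δ 0) (loopWeight κ m M δ 0) fun _ => z).2 +
          fderiv ℝ K z (1, 0)| ≤ e := by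
  set Q : Set (ℝ × ℝ) := Set.Icc (-(R + 2 * M)) (R + 2 * M) ×ˢ Set.Icc (m / 2) (2 * M) with hQ
  have hM : 0 < M := hm.trans_le hmM
  have hU : IsOpen {z : ℝ × ℝ | 0 < z.2} := isOpen_lt continuous_const continuous_snd
  have hQU : Q ⊆ {z : ℝ × ℝ | 0 < z.2} := fun p hp => (half_pos hm).trans_le hp.2.1
  have hQk : IsCompact Q := isCompact_Icc.prod isCompact_Icc
  obtain ⟨d, hd, hexp⟩ := hK.exists_uniform_expansion hU hQk
    ((convex_Icc _ _).prod (convex_Icc _ _)) hQU (ω := e / 24) (by positivity)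
  obtain ⟨S, hS⟩ := hQk.exists_bound_of_continuousOn
    ((hK.continuousOn_fderiv_of_isOpen hU le_rfl).mono hQU)
  refine ⟨min (1 / 2) (min (d / M) (e / (128 * (|S| + 1)))), by positivity, min_le_left _ _,
    fun δ hδ0 hδ κ hκ hκK z hz1 hz2 => ?_⟩
  have hδ1 := hδ.trans (min_le_left _ _)
  have hδ2 := (hδ.trans (min_le_right _ _)).trans (min_le_left _ _)
  have hδ3 := (hδ.trans (min_le_right _ _)).trans (min_le_right _ _)
  rw [le_div_iff₀ hM] at hδ2
  rw [le_div_iff₀ (by positivity)] at hδ3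
  have hy : 0 < z.2 := hm.trans_le hz2.1
  have hz1' := abs_le.1 hz1
  have hzQ : z ∈ Q := ⟨⟨by linarith, by linarith⟩, by linarith [hz2.1], by linarith [hz2.2]⟩
  have hnorm : ∀ v : ℝ × ℝ, ‖v‖ ≤ 1 → |fderiv ℝ K z v| ≤ |S| := fun v hv => by
    refine ((fderiv ℝ K z).le_opNorm v).trans ?_
    refine (mul_le_of_le_one_right (norm_nonneg _) hv).trans ((hS z hzQ).trans (le_abs_self S))
  have ha := hnorm (1, 0) (by simp)
  have hb := hnorm (0, 1) (by simp)
  have hfin : 2 * (6 * (e / 24) + 16 * δ * (|fderiv ℝ K z (1, 0)| + |fderiv ℝ K z (0, 1)|)) ≤ e := by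
    have : δ * (|fderiv ℝ K z (1, 0)| + |fderiv ℝ K z (0, 1)|) ≤ δ * (2 * |S|) :=
      mul_le_mul_of_nonneg_left (by linarith) hδ0.le
    nlinarith
  have hpt : ∀ θ, |κ (liftPoint m M δ θ z) * (liftPoint m M δ θ z).2 ^ 2 - K z -
      δ * (z.2 * fderiv ℝ K z (1, 0) * sin θ - z.2 * fderiv ℝ K z (0, 1) * cos θ)| ≤
      e / 24 * z.2 * δ := fun θ => by
    have hmem : liftPoint m M δ θ z ∈ Q :=
      liftPoint_mem_box hm hδ0.le hδ1 (hz1.trans (by linarith)) hz2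
    have hdiff : liftPoint m M δ θ z - z = (δ * z.2) • (sin θ • (1, 0) - cos θ • (0, 1)) := by
      rw [liftPoint, clamp_of_mem hz2]
      ext <;> simp
      ring
    have hle : ‖liftPoint m M δ θ z - z‖ ≤ δ * z.2 := by
      rw [hdiff, norm_smul, Real.norm_eq_abs, abs_of_pos (by positivity)]
      refine mul_le_of_le_one_right (by positivity) ?_
      simp [Prod.norm_def, abs_sin_le_one, abs_cos_le_one]
    have hle2 : δ * z.2 ≤ d := (mul_le_mul_of_nonneg_left hz2.2 hδ0.le).trans hδ2
    have h1 := (hexp z hzQ _ hmem (hle.trans hle2)).trans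
      (mul_le_mul_of_nonneg_left hle (by positivity))
    rw [hdiff, map_smul, map_sub, map_smul, map_smul, ← hκK _ hmem] at h1
    simp only [smul_eq_mul] at h1
    refine (congrArg abs ?_).trans_le (h1.trans_eq ?_) <;> ring
  obtain ⟨h1, h2⟩ := abs_multiplier_sub_le hκ hm hz2 hδ0 hδ1 hpt
  exact ⟨h1.trans hfin, h2.trans hfin⟩

theorem norm_le_abs_apply_add_abs_apply (T : ℝ × ℝ →L[ℝ] ℝ) : ‖T‖ ≤ |T (1, 0)| + |T (0, 1)| := by
  refine T.opNorm_le_bound (by positivity) fun v => ?_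
  have e : v = v.1 • ((1 : ℝ), (0 : ℝ)) + v.2 • ((0 : ℝ), (1 : ℝ)) := by ext <;> simp
  have h : T v = v.1 * T (1, 0) + v.2 * T (0, 1) := by
    conv_lhs => rw [e]
    rw [map_add, map_smul, map_smul, smul_eq_mul, smul_eq_mul]
  rw [h, Real.norm_eq_abs]
  refine (abs_add_le _ _).trans ?_
  rw [abs_mul, abs_mul]
  have h1 : |v.1| ≤ ‖v‖ := norm_fst_le v
  have h2 : |v.2| ≤ ‖v‖ := norm_snd_le v
  nlinarith [abs_nonneg (T (1, 0)), abs_nonneg (T (0, 1))]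

/-- A circle is an embedded loop of constant curvature `k ≥ 2`. -/
theorem exists_embedded_loop_const {k : ℝ} (hk : 2 ≤ k) :
    ∃ u : ℝ → ℝ × ℝ, IsKLoop (fun _ => k) u ∧ IsEmbedded u := by
  have hk0 : 0 < k := by linarith
  have h := exists_embedded_loop_of_drift (K := fun _ => 0) (κ := fun _ => 0) (m := 1) (M := 1)
    (k := k) (δ := k⁻¹) (ε := 0) (η := 0) (w := fun _ => (0, 1)) continuous_const one_pos
    (inv_pos.2 hk0) (by rw [inv_le_comm₀ hk0 (by norm_num)]; linarith)
    (mul_inv_cancel₀ hk0.ne') (zero_mul _) (fun θ => by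
      rw [zero_smul]; exact hasDerivAt_const θ _) (fun _ => rfl) (fun _ => by simp)
    (fun θ w => by simp [loopWeight]) (fun _ => by simp)
    (fun θ => by linarith [cos_le_one θ])
  simpa using h

/-- if the curvature perturbation `K` has a stable critical point in an open
set `A ⋐ H²`, then for every sufficiently large `k` and every `ε` close enough to `0`
there exists an embedded `(k+εK)`-loop. -/
theorem stmt_14 (K : (ℝ × ℝ) → ℝ)
    (hK : ContDiffOn ℝ 1 K {z : ℝ × ℝ | 0 < z.2})
    (A : Set (ℝ × ℝ)) (hAo : IsOpen A) (hAc : IsCompact (closure A))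
    (hAH : closure A ⊆ {z : ℝ × ℝ | 0 < z.2})
    (hstab : HasStableCriticalPt K A) :
    ∃ k₀ > (1:ℝ), ∀ k > k₀, ∃ ε₀ > (0:ℝ), ∀ ε : ℝ, |ε| < ε₀ →
      ∃ u : ℝ → ℝ × ℝ, IsKLoop (fun z => k + ε * K z) u ∧ IsEmbedded u := by
  have hU : IsOpen {z : ℝ × ℝ | 0 < z.2} := isOpen_lt continuous_const continuous_snd
  obtain ⟨r, hr, hstab⟩ := hstab
  obtain ⟨z₀, hz₀, -⟩ := hstab K ⟨_, hU, hAH, hK⟩ fun z _ => by simpa using hr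
  have hne : (closure A).Nonempty := ⟨z₀, subset_closure hz₀⟩
  obtain ⟨R₀, hR₀⟩ := hAc.isBounded.exists_norm_le
  obtain ⟨z₁, hz₁, hmin⟩ := hAc.exists_isMinOn hne continuous_snd.continuousOn
  have hR₀0 : 0 ≤ R₀ := (norm_nonneg _).trans (hR₀ z₁ hz₁)
  have hz₁0 : 0 < z₁.2 := hAH hz₁
  obtain ⟨m, hm, hm3⟩ : ∃ m > (0 : ℝ), 3 * m = z₁.2 := ⟨z₁.2 / 3, by positivity, by ring⟩
  obtain ⟨R, hR⟩ : ∃ R, R = R₀ + 1 := ⟨_, rfl⟩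
  obtain ⟨M, hM⟩ : ∃ M, M = R + m := ⟨_, rfl⟩
  have hmM : m ≤ M := by linarith
  have hM0 : 0 < M := hm.trans_le hmM
  set V : Set (ℝ × ℝ) := Set.Ioo (-R) R ×ˢ Set.Ioo (2 * m) (M - m) with hV
  have hVo : IsOpen V := isOpen_Ioo.prod isOpen_Ioo
  have hVc : Convex ℝ V := (convex_Ioo _ _).prod (convex_Ioo _ _)
  have hAV : closure A ⊆ V := fun z hz => by
    have h1 := abs_le.1 ((norm_fst_le z).trans (hR₀ z hz))
    have h2 := abs_le.1 ((norm_snd_le z).trans (hR₀ z hz))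
    have h3 : z₁.2 ≤ z.2 := hmin hz
    exact ⟨⟨by linarith, by linarith⟩, by linarith, by linarith⟩
  have hVU : V ⊆ {z : ℝ × ℝ | 0 < z.2} := fun z hz => by
    have : 2 * m < z.2 := hz.2.1
    exact (by linarith : (0 : ℝ) < z.2)
  have hVstrip : ∀ z ∈ V, |z.1| ≤ R ∧ z.2 ∈ Set.Icc m M := fun z hz =>
    ⟨abs_le.2 ⟨hz.1.1.le, hz.1.2.le⟩, by linarith [hz.2.1], by linarith [hz.2.2]⟩
  have hVdiam : ∀ z ∈ V, ∀ z' ∈ V, ‖z - z'‖ ≤ 2 * R + M := fun z hz z' hz' => by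
    obtain ⟨⟨a1, a2⟩, a3, a4⟩ := hz
    obtain ⟨⟨b1, b2⟩, b3, b4⟩ := hz'
    rw [Prod.norm_def]
    exact max_le (abs_le.2 ⟨by dsimp; linarith, by dsimp; linarith⟩)
      (abs_le.2 ⟨by dsimp; linarith, by dsimp; linarith⟩)
  obtain ⟨e, he, hre⟩ : ∃ e > (0 : ℝ), 4 * e * (2 * R + M) + 4 * e < r := by
    have hD : 0 < 2 * R + M + 2 := by linarith
    refine ⟨r / (4 * (2 * R + M + 2)), by positivity, ?_⟩
    have : 4 * (r / (4 * (2 * R + M + 2))) * (2 * R + M + 2) = r := by field_simp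
    have : 0 < r / (4 * (2 * R + M + 2)) := by positivity
    linarith
  obtain ⟨δ₀, hδ₀, hδ₀2, hclose⟩ := exists_multiplier_close (R := R) hK hm hmM he
  obtain ⟨κ, B, L, hκ, hB, hL, hL0, hκK⟩ := exists_lipschitz_density hK (R := R + 2 * M)
    (by linarith) (half_pos hm) (by linarith : m / 2 ≤ 2 * M)
  have hB0 : 0 ≤ B := (abs_nonneg _).trans (hB 0)
  refine ⟨max 2 δ₀⁻¹, lt_max_of_lt_left one_lt_two, fun k hk => ?_⟩
  have hk2 : 2 < k := (le_max_left _ _).trans_lt hk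
  have hk0 : 0 < k := by linarith
  obtain ⟨δ, hδ⟩ : ∃ δ, δ = k⁻¹ := ⟨_, rfl⟩
  have hδ0 : 0 < δ := hδ ▸ inv_pos.2 hk0
  have hδδ₀ : δ ≤ δ₀ := by
    rw [hδ, inv_le_comm₀ hk0 hδ₀]
    exact (le_max_right _ _).trans hk.le
  have hδ2 : δ ≤ 1 / 2 := hδδ₀.trans hδ₀2
  have hkδ : k * δ = 1 := by rw [hδ, mul_inv_cancel₀ hk0.ne']
  obtain ⟨C, hC, η₀, hη₀, hred⟩ := exists_reduced_function hκ hB hL hL0 hm hmM hδ0.le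
    (hδ2.trans (by norm_num))
  refine ⟨min (min η₀ (m / C)) (min (e * δ ^ 2 / (2 * C)) (1 / (B * (2 * M) ^ 2 + 1))),
    by positivity, fun ε hε => ?_⟩
  obtain ⟨⟨hε1, hε2⟩, hε3, hε4⟩ : (|ε| < η₀ ∧ |ε| < m / C) ∧ |ε| < e * δ ^ 2 / (2 * C) ∧
      |ε| < 1 / (B * (2 * M) ^ 2 + 1) := by
    simpa only [lt_min_iff] using hε
  rcases eq_or_ne ε 0 with rfl | hε0
  · simpa using exists_embedded_loop_const hk2.le
  obtain ⟨η, hη⟩ : ∃ η, ε * δ = η := ⟨_, rfl⟩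
  have hη0 : η ≠ 0 := hη ▸ mul_ne_zero hε0 hδ0.ne'
  have hηε : |η| ≤ |ε| := by
    rw [← hη, abs_mul, abs_of_pos hδ0]
    exact mul_le_of_le_one_right (abs_nonneg _) (by linarith)
  have hηm : C * |η| ≤ m := by
    have := hηε.trans hε2.le
    rwa [le_div_iff₀ hC, mul_comm] at this
  have hηe : 2 / δ ^ 2 * (C * |η|) ≤ e := by
    have := hηε.trans hε3.le
    rw [le_div_iff₀ (by positivity)] at this
    rw [div_mul_eq_mul_div, div_le_iff₀ (by positivity)]
    linarith
  obtain ⟨W, ν, Φ, hWp, hWd, hWz, hνc, hν, hweight, hΦ⟩ := hred η hη0 (hηε.trans hε1.le)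
  have hcoef : ∀ z ∈ V, |2 / δ ^ 2 * (ν z).1 - fderiv ℝ K z (0, 1)| ≤ 2 * e ∧
      |2 / δ ^ 2 * (ν z).2 + fderiv ℝ K z (1, 0)| ≤ 2 * e := fun z hz => by
    obtain ⟨h1, h2⟩ := hclose δ hδ0 hδδ₀ κ hκ hκK z (hVstrip z hz).1 (hVstrip z hz).2
    have h3 := hν z
    set ν₀ := multiplier (loopDrift κ m M δ 0) (loopWeight κ m M δ 0) fun _ => z
    have hc : ∀ t, |t| ≤ C * |η| → |2 / δ ^ 2 * t| ≤ e := fun t ht => by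
      rw [abs_mul, abs_of_pos (by positivity : 0 < 2 / δ ^ 2)]
      exact (mul_le_mul_of_nonneg_left ht (by positivity)).trans hηe
    have h4 := abs_le.1 (hc ((ν z).1 - ν₀.1) ((norm_fst_le (ν z - ν₀)).trans h3))
    have h5 := abs_le.1 (hc ((ν z).2 - ν₀.2) ((norm_snd_le (ν z - ν₀)).trans h3))
    have h6 := abs_le.1 h1
    have h7 := abs_le.1 h2
    exact ⟨abs_le.2 ⟨by linarith, by linarith⟩, abs_le.2 ⟨by linarith, by linarith⟩⟩
  set G : ℝ × ℝ → ℝ := fun z => -(π * δ ^ 2)⁻¹ * (Φ z - Φ z₀) + K z₀ with hG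
  set G' : ℝ × ℝ → ℝ × ℝ →L[ℝ] ℝ := fun z => (-(2 / δ ^ 2)) •
    ((ν z).2 • ContinuousLinearMap.fst ℝ ℝ ℝ - (ν z).1 • ContinuousLinearMap.snd ℝ ℝ ℝ) with hG'
  have hGd : ∀ z ∈ V, HasFDerivAt G (G' z) z := fun z hz => by
    refine ((((hΦ z hz.2).sub_const (Φ z₀)).const_mul (-(π * δ ^ 2)⁻¹)).add_const
      (K z₀)).congr_fderiv ?_
    rw [hG', smul_smul]
    congr 1
    have := pi_ne_zero
    field_simp
  have hKd : ∀ z ∈ V, HasFDerivAt K (fderiv ℝ K z) z := fun z hz =>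
    ((hK.differentiableOn one_ne_zero).differentiableAt (hU.mem_nhds (hVU hz))).hasFDerivAt
  have hGK : ∀ z ∈ V, ‖G' z - fderiv ℝ K z‖ ≤ 4 * e := fun z hz => by
    obtain ⟨h1, h2⟩ := hcoef z hz
    refine (norm_le_abs_apply_add_abs_apply _).trans ?_
    have e1 : (G' z - fderiv ℝ K z) (1, 0) = -(2 / δ ^ 2 * (ν z).2 + fderiv ℝ K z (1, 0)) := by
      simp [hG']; ring
    have e2 : (G' z - fderiv ℝ K z) (0, 1) = 2 / δ ^ 2 * (ν z).1 - fderiv ℝ K z (0, 1) := by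
      simp [hG']
    rw [e1, e2, abs_neg]
    linarith
  have hGc : ContDiffOn ℝ 1 G V := by
    rw [show (1 : WithTop ℕ∞) = 0 + 1 from rfl, contDiffOn_succ_iff_fderiv_of_isOpen hVo]
    refine ⟨fun z hz => (hGd z hz).differentiableAt.differentiableWithinAt, by simp, ?_⟩
    rw [contDiffOn_zero]
    have hc : Continuous G' := by fun_prop
    exact hc.continuousOn.congr fun z hz => (hGd z hz).fderiv
  have hz₀V : z₀ ∈ V := hAV (subset_closure hz₀)
  have hval : ∀ z ∈ V, |G z - K z| ≤ 4 * e * (2 * R + M) := fun z hz => by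
    have h1 := hVc.norm_image_sub_le_of_norm_hasFDerivWithin_le (𝕜 := ℝ) (f := fun z => G z - K z)
      (f' := fun z => G' z - fderiv ℝ K z)
      (fun z hz => ((hGd z hz).sub (hKd z hz)).hasFDerivWithinAt) hGK hz₀V hz
    have h2 : G z₀ - K z₀ = 0 := by simp [hG]
    rw [h2, sub_zero] at h1
    exact h1.trans (mul_le_mul_of_nonneg_left (hVdiam z hz z₀ hz₀V) (by positivity))
  obtain ⟨z, hzA, hz⟩ := hstab G ⟨V, hVo, hAV, hGc⟩ fun z hz => by
    rw [(hGd z (hAV hz)).fderiv]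
    linarith [hval z (hAV hz), hGK z (hAV hz)]
  have hzV : z ∈ V := hAV (subset_closure hzA)
  rw [(hGd z hzV).fderiv] at hz
  have hν0 : ν z = 0 := by
    have h1 := congrArg (fun T : ℝ × ℝ →L[ℝ] ℝ => T (1, 0)) hz
    have h2 := congrArg (fun T : ℝ × ℝ →L[ℝ] ℝ => T (0, 1)) hz
    simp [hG', hδ0.ne'] at h1 h2
    exact Prod.ext h2 h1
  have hWstrip : ∀ θ, |(W z θ).1| ≤ R + M ∧ (W z θ).2 ∈ Set.Icc m M := fun θ => by
    have h1 := abs_le.1 ((norm_fst_le (W z θ - z)).trans ((hWz z θ).trans hηm))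
    have h2 := abs_le.1 ((norm_snd_le (W z θ - z)).trans ((hWz z θ).trans hηm))
    obtain ⟨⟨a1, a2⟩, a3, a4⟩ := hzV
    simp only [Prod.fst_sub, Prod.snd_sub] at h1 h2
    exact ⟨abs_le.2 ⟨by linarith, by linarith⟩, by linarith, by linarith⟩
  have hbox : ∀ θ, liftCurve δ (W z) θ ∈
      Set.Icc (-(R + 2 * M)) (R + 2 * M) ×ˢ Set.Icc (m / 2) (2 * M) := fun θ => by
    rw [liftCurve_eq_liftPoint (hWstrip θ).2]
    exact liftPoint_mem_box hm hδ0.le hδ2 (hWstrip θ).1 (hWstrip θ).2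
  refine exists_embedded_loop_of_drift hκ hm hδ0 hδ2 hkδ hη (w := W z) (fun θ => ?_) (hWp z)
    (fun θ => (hWstrip θ).2) hweight (fun θ => hκK _ (hbox θ)) fun θ => ?_
  · simpa [hν0] using hWd z θ
  · have h1 : |ε * K (liftCurve δ (W z) θ)| ≤ 1 := by
      rw [← hκK _ (hbox θ), abs_mul, abs_mul, abs_pow]
      have h2 := (hbox θ).2
      rw [lt_div_iff₀ (by positivity)] at hε4
      have h3 : |(liftCurve δ (W z) θ).2| ≤ 2 * M := abs_le.2 ⟨by linarith [h2.1], h2.2⟩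
      calc |ε| * (|κ (liftCurve δ (W z) θ)| * |(liftCurve δ (W z) θ).2| ^ 2)
          ≤ |ε| * (B * (2 * M) ^ 2) := by
            gcongr
            exact hB _
        _ ≤ 1 := by linarith [abs_nonneg ε]
    linarith [(abs_le.1 h1).1, cos_le_one θ]
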